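/- Let F be a field of characteristic p > 0 and D a division p-algebra of degree m over F which is split by a purely inseparable field extension K/F of exponent one with m < [K:F] = p^e. Then there exist a derivation δ on K with Const(δ) = F and an irreducible differential polynomial f ∈ K[t;δ] of degree m such that S_f = K[t;δ]/K[t;δ]f is a division algebra over F of dimension m·p^e with right nucleus isomorphic to D, left and middle nuclei equal to K, and nucleus D ∩ K an intermediate field of K/F properly contained in K. -/

import Mathlib

open scoped TensorProduct

/-! ## A framework for differential polynomial rings `K[t;δ]` and Petit algebras `S_f`. -/

/-- A derivation on a field `K`: an additive map satisfying the Leibniz rule. -/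
structure Der (K : Type) [Field K] where
  toFun : K → K
  map_add' : ∀ a b : K, toFun (a + b) = toFun a + toFun b
  leibniz' : ∀ a b : K, toFun (a * b) = a * toFun b + toFun a * b

/-- `F` (given as a subfield of `K` via `algebraMap F K`) is precisely the field of
constants `Const(δ) = {a ∈ K | δ(a) = 0}` of the derivation `δ`. -/
def Der.HasConstants {K : Type} [Field K] (δ : Der K) (F : Type) [Field F]
    [Algebra F K] : Prop :=
  ∀ a : K, δ.toFun a = 0 ↔ ∃ c : F, algebraMap F K c = a

/-- The map `V_p(b) = b^p + δ^{p-1}(b)`. -/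
def Der.Vp {K : Type} [Field K] (δ : Der K) (p : ℕ) (b : K) : K :=
  b ^ p + δ.toFun^[p - 1] b

/-- The `e`-fold iterate `V_{p^e}` of `V_p`. -/
def Der.VpIter {K : Type} [Field K] (δ : Der K) (p e : ℕ) : K → K :=
  (δ.Vp p)^[e]

/-- A realization of the differential polynomial ring `R = K[t;δ]`: a ring `R`
together with an embedding `i : K → R` and an element `t` satisfying the
twist relation `t·a = a·t + δ(a)`, such that every element of `R` is *uniquely*
a left `K`-linear combination of the powers `t^n` (witnessed by the coefficient
function `coeff`), and such that `R` admits a right division algorithm. -/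
structure DiffPolyRing (K : Type) [Field K] (δ : Der K) (R : Type) [Ring R] where
  i : K →+* R
  t : R
  coeff : R → (ℕ →₀ K)
  t_mul : ∀ a : K, t * i a = i a * t + i (δ.toFun a)
  repr' : ∀ x : R, x = (coeff x).sum fun n a => i a * t ^ n
  coeff_unique : ∀ (x : R) (c : ℕ →₀ K), x = (c.sum fun n a => i a * t ^ n) → c = coeff x
  rightDiv : ∀ f x : R, f ≠ 0 → ∃! r : R,
    (∃ q : R, x = q * f + r) ∧ (coeff r).support.max < (coeff f).support.max

namespace DiffPolyRing

variable {K : Type} [Field K] {δ : Der K} {R : Type} [Ring R]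

/-- The degree of a differential polynomial, with `deg 0 = ⊥`. -/
def deg (D : DiffPolyRing K δ R) (x : R) : WithBot ℕ := (D.coeff x).support.max

lemma coeff_zero (D : DiffPolyRing K δ R) : D.coeff 0 = 0 :=
  (D.coeff_unique 0 0 (by simp)).symm

lemma deg_zero (D : DiffPolyRing K δ R) : D.deg 0 = ⊥ := by
  simp [deg, D.coeff_zero]

lemma coeff_add (D : DiffPolyRing K δ R) (x y : R) :
    D.coeff (x + y) = D.coeff x + D.coeff y := by
  refine (D.coeff_unique _ _ ?_).symm
  rw [Finsupp.sum_add_index' (by simp) (by intro n a b; rw [map_add, add_mul])]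
  conv_lhs => rw [D.repr' x, D.repr' y]

lemma coeff_neg (D : DiffPolyRing K δ R) (x : R) : D.coeff (-x) = -D.coeff x := by
  have h := D.coeff_add (-x) x
  rw [neg_add_cancel, D.coeff_zero] at h
  exact eq_neg_of_add_eq_zero_left h.symm

lemma deg_neg (D : DiffPolyRing K δ R) (x : R) : D.deg (-x) = D.deg x := by
  simp [deg, D.coeff_neg]

lemma deg_add_lt (D : DiffPolyRing K δ R) {x y : R} {n : WithBot ℕ}
    (hx : D.deg x < n) (hy : D.deg y < n) : D.deg (x + y) < n := by
  have hsub : (D.coeff (x + y)).support ⊆ (D.coeff x).support ∪ (D.coeff y).support := by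
    rw [D.coeff_add]; exact Finsupp.support_add
  calc D.deg (x + y) ≤ ((D.coeff x).support ∪ (D.coeff y).support).max :=
        Finset.max_mono hsub
    _ = max (D.deg x) (D.deg y) := Finset.max_union
    _ < n := max_lt hx hy

lemma coeff_smul (D : DiffPolyRing K δ R) (c : K) (x : R) :
    D.coeff (D.i c * x) = c • D.coeff x := by
  refine (D.coeff_unique _ _ ?_).symm
  rw [Finsupp.sum_smul_index (by simp)]
  conv_lhs => rw [D.repr' x, Finsupp.mul_sum]
  exact Finsupp.sum_congr fun n _ => by rw [← mul_assoc, ← map_mul]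

lemma deg_i_mul_lt (D : DiffPolyRing K δ R) (c : K) {x : R} {n : WithBot ℕ}
    (hx : D.deg x < n) : D.deg (D.i c * x) < n := by
  have hsub : (D.coeff (D.i c * x)).support ⊆ (D.coeff x).support := by
    rw [D.coeff_smul]; exact Finsupp.support_smul
  exact lt_of_le_of_lt (Finset.max_mono hsub) hx

/-- The additive subgroup of `R` consisting of the differential polynomials of
degree `< m`; this is the underlying set of the Petit algebra `S_f` for `deg f = m`. -/
def res (D : DiffPolyRing K δ R) (m : ℕ) : AddSubgroup R where
  carrier := {x | D.deg x < (m : WithBot ℕ)}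
  add_mem' hx hy := D.deg_add_lt hx hy
  zero_mem' := by
    show D.deg 0 < (m : WithBot ℕ)
    rw [D.deg_zero]
    exact bot_lt_iff_ne_bot.2 (by simp)
  neg_mem' {x} hx := by
    show D.deg (-x) < (m : WithBot ℕ)
    rw [D.deg_neg]; exact hx

/-- The underlying set `{g ∈ K[t;δ] | deg g < m}` of the Petit algebra `S_f`
(for `f` of degree `m`), viewed as a subset of `R = K[t;δ]`. -/
def SfSet (D : DiffPolyRing K δ R) (m : ℕ) : Set R := {x | D.deg x < (m : WithBot ℕ)}

/-- The underlying `F`-vector space of the Petit algebra `S_f`, for `f` of degree `m`. -/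
abbrev Rlt (D : DiffPolyRing K δ R) (m : ℕ) : Type := ↥(D.res m)

instance instSMul {F : Type} [Field F] [Algebra F K] (D : DiffPolyRing K δ R) (m : ℕ) :
    SMul F (D.Rlt m) :=
  ⟨fun c x => ⟨D.i (algebraMap F K c) * (x : R), D.deg_i_mul_lt _ x.2⟩⟩

lemma smul_coe {F : Type} [Field F] [Algebra F K] (D : DiffPolyRing K δ R) (m : ℕ)
    (c : F) (x : D.Rlt m) : ((c • x : D.Rlt m) : R) = D.i (algebraMap F K c) * (x : R) := rfl

/-- The `F`-vector space structure of the Petit algebra (where `F ⊆ K` is the field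
of constants): `c • x = i(c)·x`. -/
instance instModule {F : Type} [Field F] [Algebra F K] (D : DiffPolyRing K δ R) (m : ℕ) :
    Module F (D.Rlt m) where
  one_smul x := Subtype.ext <| by rw [smul_coe]; simp
  mul_smul a b x := Subtype.ext <| by rw [smul_coe, smul_coe, smul_coe]; simp [mul_assoc]
  smul_zero a := Subtype.ext <| by rw [smul_coe]; simp
  smul_add a x y := Subtype.ext <| by
    rw [smul_coe]
    push_cast
    rw [smul_coe, smul_coe, mul_add]
  add_smul a b x := Subtype.ext <| by
    push_cast
    rw [smul_coe, smul_coe, smul_coe]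
    simp [add_mul]
  zero_smul x := Subtype.ext <| by rw [smul_coe]; simp

open Classical in
/-- The remainder `mod_r f` of right division by `f`. -/
noncomputable def modr (D : DiffPolyRing K δ R) (f x : R) : R :=
  if h : ∃! r : R, (∃ q : R, x = q * f + r) ∧
      (D.coeff r).support.max < (D.coeff f).support.max then h.choose else 0

/-- The multiplication of the Petit algebra `S_f`: `g ∘ h = g·h mod_r f`. -/
noncomputable def pmul (D : DiffPolyRing K δ R) (f x y : R) : R := D.modr f (x * y)

/-- The left nucleus of the Petit algebra `S_f`, as a subset of `R`. -/
def nucl (D : DiffPolyRing K δ R) (f : R) (m : ℕ) : Set R :=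
  {x ∈ D.SfSet m | ∀ y ∈ D.SfSet m, ∀ z ∈ D.SfSet m,
    D.pmul f (D.pmul f x y) z = D.pmul f x (D.pmul f y z)}

/-- The middle nucleus of the Petit algebra `S_f`, as a subset of `R`. -/
def nucm (D : DiffPolyRing K δ R) (f : R) (m : ℕ) : Set R :=
  {x ∈ D.SfSet m | ∀ y ∈ D.SfSet m, ∀ z ∈ D.SfSet m,
    D.pmul f (D.pmul f y x) z = D.pmul f y (D.pmul f x z)}

/-- The right nucleus of the Petit algebra `S_f`, as a subset of `R`. -/
def nucr (D : DiffPolyRing K δ R) (f : R) (m : ℕ) : Set R :=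
  {x ∈ D.SfSet m | ∀ y ∈ D.SfSet m, ∀ z ∈ D.SfSet m,
    D.pmul f (D.pmul f y z) x = D.pmul f y (D.pmul f z x)}

/-- The nucleus of the Petit algebra `S_f`, as a subset of `R`. -/
def nuc (D : DiffPolyRing K δ R) (f : R) (m : ℕ) : Set R :=
  D.nucl f m ∩ D.nucm f m ∩ D.nucr f m

/-- `f` is irreducible in `K[t;δ]`: it is not a unit and admits no factorization
into two factors of strictly smaller degree. -/
def Irred (D : DiffPolyRing K δ R) (f : R) : Prop :=
  ¬IsUnit f ∧ ¬∃ g h : R, f = g * h ∧ D.deg g < D.deg f ∧ D.deg h < D.deg f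

/-- The Petit algebra `S_f` is a division algebra: it is nonzero, and all left and
right multiplications by nonzero elements are bijective. -/
def IsDivisionPetit (D : DiffPolyRing K δ R) (f : R) (m : ℕ) : Prop :=
  (∃ x ∈ D.SfSet m, x ≠ 0) ∧ ∀ a ∈ D.SfSet m, a ≠ 0 →
    Set.BijOn (fun x => D.pmul f a x) (D.SfSet m) (D.SfSet m) ∧
    Set.BijOn (fun x => D.pmul f x a) (D.SfSet m) (D.SfSet m)

/-- The unital `F`-algebra `B` realizes the right nucleus of the Petit algebra `S_f`:
there is a bijection `B ≃ Nuc_r(S_f)` preserving addition, multiplication and the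
`F`-algebra structure. -/
def RightNucPresents (F : Type) [Field F] [Algebra F K] (D : DiffPolyRing K δ R)
    (f : R) (m : ℕ) (B : Type) [Ring B] [Algebra F B] : Prop :=
  ∃ φ : B ≃ (D.nucr f m),
    (∀ x y : B, ((φ (x + y) : R)) = (φ x : R) + (φ y : R)) ∧
    (∀ x y : B, ((φ (x * y) : R)) = D.pmul f (φ x : R) (φ y : R)) ∧
    (∀ c : F, ((φ (algebraMap F B c) : R)) = D.i (algebraMap F K c))

/-- A subset `S` of an `F`-vector space has dimension `d`: it contains `d` linearly
independent vectors whose span contains `S`. -/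
def SetDim (F : Type) [Field F] {M : Type} [AddCommGroup M] [Module F M]
    (S : Set M) (d : ℕ) : Prop :=
  ∃ s : Finset M, ↑s ⊆ S ∧ s.card = d ∧
    LinearIndependent F (fun x : (s : Set M) => (x : M)) ∧
    S ⊆ (Submodule.span F (s : Set M) : Set M)

/-- `f ∈ K[t;δ]` of degree `m` is an `A`-polynomial (over the field of constants `F`),
via Amitsur's characterization: the right nucleus of `S_f` has dimension `m²` over `F`. -/
def IsAPoly (F : Type) [Field F] [Algebra F K] (D : DiffPolyRing K δ R)
    (f : R) (m : ℕ) : Prop :=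
  SetDim F {x : D.Rlt m | (x : R) ∈ D.nucr f m} (m ^ 2)

/-- `f ∈ R = K[t;δ]` is bounded: there is `f* ≠ 0` such that `Rf* = f*R` is the
largest two-sided ideal of `R` contained in `Rf`. -/
def IsBounded (D : DiffPolyRing K δ R) (f : R) : Prop :=
  ∃ fs : R, fs ≠ 0 ∧
    {x : R | ∃ r, x = r * fs} = {x : R | ∃ r, x = fs * r} ∧
    (∀ x : R, (∃ r, x = r * fs) → ∃ r, x = r * f) ∧
    ∀ J : Set R, (0 : R) ∈ J → (∀ a ∈ J, ∀ b ∈ J, a + b ∈ J) →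
      (∀ r : R, ∀ a ∈ J, r * a ∈ J ∧ a * r ∈ J) →
      (∀ x ∈ J, ∃ r, x = r * f) → ∀ x ∈ J, ∃ r, x = r * fs

/-- `S_f` is a free right module of rank `n` over its right nucleus. -/
def FreeRankOverNucr (D : DiffPolyRing K δ R) (f : R) (m n : ℕ) : Prop :=
  ∃ b : Fin n → R, (∀ j, b j ∈ D.SfSet m) ∧
    ∀ x ∈ D.SfSet m, ∃! c : Fin n → (D.nucr f m),
      x = ∑ j, D.pmul f (b j) ((c j : R))

/-- The Petit algebra `S_f` is unital with unit `1 ∈ K[t;δ]`. -/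
def PetitUnital (D : DiffPolyRing K δ R) (f : R) (m : ℕ) : Prop :=
  (1 : R) ∈ D.SfSet m ∧ ∀ x ∈ D.SfSet m, D.pmul f 1 x = x ∧ D.pmul f x 1 = x

end DiffPolyRing

/-! ### Helpers for the characteristic `p` theory -/

/-- `B` is a `p`-algebra over `F`: a (finite-dimensional) central simple `F`-algebra
whose index is a power of `p`, i.e. `B ≅ Mat_k(Dv)` for a central division algebra `Dv`
of degree a power of `p`. -/
def IsPAlgebra (p : ℕ) (F B : Type) [Field F] [Ring B] [Algebra F B] : Prop :=
  Algebra.IsCentral F B ∧ IsSimpleRing B ∧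
    ∃ (Dv : Type) (_ : DivisionRing Dv) (_ : Algebra F Dv) (k n : ℕ),
      Nonempty (B ≃ₐ[F] Matrix (Fin k) (Fin k) Dv) ∧ Module.finrank F Dv = (p ^ n) ^ 2

/-- `δ` is an algebraic derivation of degree `p^e` with minimum polynomial
`g(t) = t^{p^e} + c₁ t^{p^{e-1}} + ⋯ + c_e t` (coefficients in the constant field `F`):
`g(δ) = 0` as an additive map on `K`, and no `p`-polynomial of smaller degree
annihilates `δ`. -/
def Der.IsMinPoly {K : Type} [Field K] (δ : Der K) {F : Type} [Field F] [Algebra F K]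
    (p e : ℕ) (c : Fin e → F) : Prop :=
  (∀ a : K, δ.toFun^[p ^ e] a
      + ∑ i : Fin e, algebraMap F K (c i) * δ.toFun^[p ^ (e - 1 - (i : ℕ))] a = 0) ∧
  ∀ e' : ℕ, e' < e → ∀ c' : Fin e' → F, ¬ ∀ a : K, δ.toFun^[p ^ e'] a
      + ∑ i : Fin e', algebraMap F K (c' i) * δ.toFun^[p ^ (e' - 1 - (i : ℕ))] a = 0

/-- The two-sided element `z = g(t) - d₀ = t^{p^e} + c₁ t^{p^{e-1}} + ⋯ + c_e t - d₀`
of `K[t;δ]`. -/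
def DiffPolyRing.gElt {K : Type} [Field K] {δ : Der K} {R : Type} [Ring R]
    (D : DiffPolyRing K δ R) {F : Type} [Field F] [Algebra F K]
    (p e : ℕ) (c : Fin e → F) (d₀ : F) : R :=
  D.t ^ p ^ e + ∑ i : Fin e, D.i (algebraMap F K (c i)) * D.t ^ p ^ (e - 1 - (i : ℕ))
    - D.i (algebraMap F K d₀)

open Polynomial in
theorem exists_derivation_extension {F L M : Type*} [Field F] [Field L] [Field M] [Algebra F L]
    [Algebra L M] [Algebra F M] [IsScalarTower F L M] [FiniteDimensional F L] (p : ℕ)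
    [hp : Fact p.Prime] [CharP L p] (x : M) (c : F) (hx : x ^ p = algebraMap F M c)
    (hxL : x ∉ (algebraMap L M).range) (hgen : Function.Surjective (aeval (R := L) x))
    (d : Derivation ℤ L L) (hd : ∀ a, d a = 0 ↔ a ∈ (algebraMap F L).range) :
    ∃ d' : Derivation ℤ M M, ∀ a, d' a = 0 ↔ a ∈ (algebraMap F M).range := by
  have hdF (c : F) : d (algebraMap F L c) = 0 := (hd _).2 ⟨c, rfl⟩
  obtain ⟨u, hu⟩ : ∃ u : L, ∀ a, d a ≠ u := by
    by_contra! h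
    let dF : L →ₗ[F] L :=
      { toFun := d
        map_add' := map_add d
        map_smul' := fun c a => by simp [Algebra.smul_def, hdF] }
    have hinj : Function.Injective dF := LinearMap.injective_iff_surjective.2 h
    exact one_ne_zero (hinj (show dF 1 = dF 0 by simp [dF]))
  let _ : Differential L := ⟨d⟩
  let D : Derivation ℤ L[X] L[X] := Differential.implicitDeriv (C u)
  set μ : L[X] := X ^ p - C (algebraMap F L c) with hμ
  have hp0 : p ≠ 0 := hp.out.ne_zero
  have hmonic : μ.Monic := monic_X_pow_sub_C _ hp0
  have hμdeg : μ.natDegree = p := natDegree_X_pow_sub_C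
  have hroot : aeval x μ = 0 := by
    simp [hμ, hx, ← IsScalarTower.algebraMap_apply]
  have : CharP M p := charP_of_injective_algebraMap (algebraMap L M).injective p
  have hirr : Irreducible μ := by
    refine X_pow_sub_C_irreducible_of_prime hp.out fun b hb => hxL ⟨b, ?_⟩
    refine frobenius_inj M p ?_
    simp only [frobenius_def]
    rw [hx, ← map_pow, hb, ← IsScalarTower.algebraMap_apply]
  have hmin : minpoly L x = μ := (minpoly.eq_of_irreducible_of_monic hirr hroot hmonic).symm
  have hDcoeff (P : L[X]) (i : ℕ) :
      (D P).coeff i = d (P.coeff i) + (i + 1) * P.coeff (i + 1) * u := by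
    simp only [D, Differential.implicitDeriv, Derivation.add_apply, coeff_add,
      Differential.coeff_mapCoeffs]
    congr 1
    rw [Derivation.coe_smul, Pi.smul_apply, Derivation.restrictScalars_apply, derivative'_apply,
      smul_eq_mul, coeff_C_mul, coeff_derivative]
    ring
  have hDμ : D μ = 0 := by
    have hdc : Differential.deriv (algebraMap F L c) = 0 := hdF c
    simp [D, hμ, hdc]
  let f : L[X] →ₐ[ℤ] M := (aeval (R := L) x).restrictScalars ℤ
  have hfs : Function.Surjective f := hgen
  have hker (P : L[X]) (hP : f P = 0) : f (D P) = 0 := by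
    change aeval x P = 0 at hP
    change aeval x (D P) = 0
    obtain ⟨Q, rfl⟩ := hmin ▸ minpoly.dvd L x hP
    simp [hDμ, hroot]
  refine ⟨Derivation.liftOfSurjective (f := f) hfs (d := D) hker, fun a => ?_⟩
  obtain ⟨P₀, rfl⟩ := hfs a
  set P := P₀ %ₘ μ with hP
  have hPf : f P₀ = f P := by
    have := modByMonic_add_div P₀ μ
    rw [← this]
    simp [f, hroot, hP]
  have hPdeg : P.natDegree < p := hμdeg ▸ natDegree_modByMonic_lt _ hmonic (by
    intro h; rw [h] at hμdeg; simp at hμdeg; exact hp0 hμdeg.symm)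
  rw [hPf, Derivation.liftOfSurjective_apply]
  constructor
  · intro h
    have hD0 : D P = 0 := by
      by_contra hne
      have h1 := natDegree_le_of_degree_le
        (degree_le_natDegree.trans' (minpoly.degree_le_of_ne_zero L x hne h))
      rw [hmin, hμdeg] at h1
      have h2 : (D P).natDegree ≤ P.natDegree := by
        refine natDegree_le_iff_coeff_eq_zero.2 fun N hN => ?_
        rw [hDcoeff, coeff_eq_zero_of_natDegree_lt hN,
          coeff_eq_zero_of_natDegree_lt (hN.trans (Nat.lt_succ_self N))]
        simp
      omega
    have hco (i : ℕ) : d (P.coeff i) + (i + 1) * P.coeff (i + 1) * u = 0 := by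
      rw [← hDcoeff, hD0, coeff_zero]
    obtain hn | ⟨n, hn⟩ : P.natDegree = 0 ∨ ∃ n, P.natDegree = n + 1 := by
      cases P.natDegree <;> simp
    · rw [eq_C_of_natDegree_eq_zero hn] at hco ⊢
      obtain ⟨b, hb⟩ := (hd (P.coeff 0)).1 (by simpa using hco 0)
      exact ⟨b, by simp [f, ← hb, ← IsScalarTower.algebraMap_apply]⟩
    · exfalso
      have h1 := hco (n + 1)
      rw [coeff_eq_zero_of_natDegree_lt (show P.natDegree < n + 1 + 1 by omega)] at h1
      obtain ⟨b, hb⟩ := (hd (P.coeff (n + 1))).1 (by simpa using h1)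
      have hb0 : P.coeff (n + 1) ≠ 0 := by
        rw [← hn, coeff_natDegree, leadingCoeff_ne_zero]
        rintro h0
        simp [h0] at hn
      have hn0 : ((n : L) + 1) ≠ 0 := by
        have := mt (CharP.cast_eq_zero_iff L p (n + 1)).1
          (Nat.not_dvd_of_pos_of_lt (Nat.succ_pos n) (by omega))
        exact_mod_cast this
      have hq : d ((n + 1) * P.coeff (n + 1)) = 0 := by
        refine (hd _).2 ⟨(n + 1) * b, by simp [hb]⟩
      refine hu (-(P.coeff n) * ((n + 1) * P.coeff (n + 1))⁻¹) ?_
      have h2 := hco n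
      rw [Derivation.leibniz, Derivation.leibniz_inv, hq]
      simp only [map_neg, smul_eq_mul]
      have h3 : d (P.coeff n) = -((n + 1) * P.coeff (n + 1) * u) := by linear_combination h2
      rw [h3]
      field_simp
      ring
  · rintro ⟨b, hb⟩
    have : f P = f (C (algebraMap F L b)) := by
      rw [← hb]; simp [f, ← IsScalarTower.algebraMap_apply]
    rw [← Derivation.liftOfSurjective_apply hfs hker, this, Derivation.liftOfSurjective_apply]
    have hdb : Differential.deriv (algebraMap F L b) = 0 := hdF b
    simp [D, hdb]

theorem exists_derivation_constants (p : ℕ) [Fact p.Prime] (F K : Type*) [Field F] [Field K]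
    [Algebra F K] [FiniteDimensional F K] (hK : ∀ z : K, z ^ p ∈ (algebraMap F K).range)
    [CharP K p] :
    ∃ d : Derivation ℤ K K, ∀ a, d a = 0 ↔ a ∈ (algebraMap F K).range := by
  let S : Set (IntermediateField F K) :=
    {L | ∃ d : Derivation ℤ L L, ∀ a, d a = 0 ↔ a ∈ (algebraMap F L).range}
  have hbot : S.Nonempty := by
    refine ⟨⊥, 0, fun a => ?_⟩
    obtain ⟨b, hb⟩ := IntermediateField.mem_bot.1 a.2
    simp only [Derivation.coe_zero, Pi.zero_apply, true_iff]
    exact ⟨b, Subtype.ext hb⟩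
  obtain ⟨L, ⟨d, hd⟩, hmax⟩ := WellFounded.has_min
    (InvImage.wf (fun L : IntermediateField F K => L.toSubalgebra.toSubmodule)
      (wellFounded_gt (α := Submodule F K))) S hbot
  have htop : ∀ x : K, x ∈ L := by
    by_contra! hx
    obtain ⟨x, hx⟩ := hx
    obtain ⟨c, hc⟩ := hK x
    let M := (IntermediateField.adjoin L {x})
    have : CharP L p :=
      (RingHom.charP_iff (algebraMap L K) (algebraMap L K).injective p).2 inferInstance
    let x' : M := IntermediateField.AdjoinSimple.gen L x
    have hint : IsIntegral L x := Algebra.IsIntegral.isIntegral x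
    obtain ⟨d', hd'⟩ := exists_derivation_extension (F := F) (L := L) (M := M) p x' c
      (Subtype.ext hc.symm)
      (by
        rintro ⟨y, hy⟩
        apply hx
        have := congrArg Subtype.val hy
        simp [x', IntermediateField.AdjoinSimple.coe_gen] at this
        rw [← this]; exact y.2)
      (by
        intro y
        obtain ⟨q, hq⟩ := (IntermediateField.adjoin.powerBasis hint).exists_eq_aeval' y
        exact ⟨q, hq.symm⟩) d hd
    refine hmax (M.restrictScalars F) ⟨d', hd'⟩ ?_
    refine lt_of_le_not_ge (fun y hy => ?_) fun h => hx (h ?_)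
    · exact IntermediateField.algebraMap_mem M ⟨y, hy⟩
    · exact IntermediateField.mem_adjoin_simple_self L x
  have hL : L = ⊤ := by ext; simp [htop]
  subst hL
  let e : (⊤ : IntermediateField F K) ≃ₐ[F] K := IntermediateField.topEquiv
  refine ⟨Derivation.mk' ((e.toRingEquiv.toAddEquiv.toAddMonoidHom.comp
    (d.toLinearMap.toAddMonoidHom.comp
      e.symm.toRingEquiv.toAddEquiv.toAddMonoidHom)).toIntLinearMap)
    fun a b => ?_, fun a => ?_⟩
  · simp
  · have := hd (e.symm a)
    simp only [RingHom.mem_range] at this ⊢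
    refine Iff.trans ?_ (this.trans ?_)
    · simp [e]
    · refine exists_congr fun c => ?_
      rw [AlgEquiv.eq_symm_apply]
      simp

namespace Der

open Polynomial

variable {K : Type} [Field K] (δ : Der K)

/-- The underlying additive map of a derivation. -/
def toAddMonoidHom : K →+ K := AddMonoidHom.mk' δ.toFun δ.map_add'

/-- A derivation as an element of the ring of additive endomorphisms. -/
def toEnd : AddMonoid.End K := δ.toAddMonoidHom

theorem map_sum {ι : Type*} (s : Finset ι) (g : ι → K) :
    δ.toFun (∑ i ∈ s, g i) = ∑ i ∈ s, δ.toFun (g i) := _root_.map_sum δ.toAddMonoidHom g s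

theorem map_zero : δ.toFun 0 = 0 := _root_.map_zero δ.toAddMonoidHom

theorem map_one : δ.toFun 1 = 0 := by simpa using δ.leibniz' 1 1

/-- A derivation as a `ℤ`-linear derivation of Mathlib. -/
def toDerivation : Derivation ℤ K K :=
  Derivation.mk' δ.toAddMonoidHom.toIntLinearMap fun a b => by
    simpa [toAddMonoidHom, mul_comm b] using δ.leibniz' a b

/-- The additive map applying a derivation to all coefficients of a polynomial. -/
noncomputable def mapCoeffs : K[X] →+ K[X] :=
  letI : Differential K := ⟨δ.toDerivation⟩
  (Differential.mapCoeffs : Derivation ℤ K[X] K[X]).toLinearMap.toAddMonoidHom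

theorem coeff_mapCoeffs (P : K[X]) (n : ℕ) :
    (δ.mapCoeffs P).coeff n = δ.toFun (P.coeff n) := rfl

/-- Left multiplication by `t` on `K[t;δ]`, in terms of coefficients. -/
noncomputable def shift : AddMonoid.End K[X] := AddMonoidHom.mulLeft X + δ.mapCoeffs

theorem shift_apply (P : K[X]) : δ.shift P = X * P + δ.mapCoeffs P := rfl

theorem coeff_shift_succ (P : K[X]) (n : ℕ) :
    (δ.shift P).coeff (n + 1) = P.coeff n + δ.toFun (P.coeff (n + 1)) := by
  rw [shift_apply, coeff_add, coeff_X_mul, coeff_mapCoeffs]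

theorem shift_smul (a : K) (P : K[X]) : δ.shift (a • P) = a • δ.shift P + δ.toFun a • P := by
  ext n
  simp only [shift_apply, coeff_add, coeff_mapCoeffs, coeff_smul, smul_eq_mul, δ.leibniz',
    mul_smul_comm]
  ring

theorem shift_monomial (n : ℕ) (a : K) :
    δ.shift (monomial n a) = monomial (n + 1) a + monomial n (δ.toFun a) := by
  ext k
  simp only [shift_apply, coeff_add, coeff_mapCoeffs, X_mul_monomial, coeff_monomial]
  split_ifs <;> simp [δ.map_zero]

theorem shift_pow_succ_apply (n : ℕ) (P : K[X]) :
    (δ.shift ^ (n + 1)) P = δ.shift ((δ.shift ^ n) P) := by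
  rw [pow_succ']; rfl

theorem shift_pow_one (n : ℕ) : (δ.shift ^ n) 1 = X ^ n := by
  induction n with
  | zero => simp
  | succ n ih =>
    rw [shift_pow_succ_apply, ih, ← monomial_one_right_eq_X_pow, shift_monomial,
      δ.map_one, monomial_zero_right, add_zero, monomial_one_right_eq_X_pow]

theorem coeff_shift_pow {P : K[X]} {b : ℕ} (hP : P.natDegree ≤ b) (n : ℕ) :
    ((δ.shift ^ n) P).natDegree ≤ n + b ∧ ((δ.shift ^ n) P).coeff (n + b) = P.coeff b := by
  induction n with
  | zero => simpa
  | succ n ih =>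
    have hz {k : ℕ} (hk : n + b < k) : ((δ.shift ^ n) P).coeff k = 0 :=
      coeff_eq_zero_of_natDegree_lt (ih.1.trans_lt hk)
    rw [shift_pow_succ_apply]
    constructor
    · refine natDegree_le_iff_coeff_eq_zero.2 fun k hk => ?_
      obtain ⟨k, rfl⟩ := Nat.exists_eq_succ_of_ne_zero (show k ≠ 0 by omega)
      rw [Nat.succ_eq_add_one, coeff_shift_succ, hz (by omega), hz (by omega), δ.map_zero,
        add_zero]
    · rw [show n + 1 + b = n + b + 1 by ring, coeff_shift_succ, ih.2, hz (Nat.lt_succ_self _),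
        δ.map_zero, add_zero]

/-- Left multiplication by the differential polynomial with coefficients `P`. -/
noncomputable def leftMul (P : K[X]) : AddMonoid.End K[X] :=
  P.eval₂ (Module.toAddMonoidEnd K K[X]) δ.shift

theorem leftMul_monomial (n : ℕ) (a : K) (Q : K[X]) :
    δ.leftMul (monomial n a) Q = a • (δ.shift ^ n) Q := by
  rw [leftMul, eval₂_monomial]; rfl

theorem leftMul_add (P P' Q : K[X]) :
    δ.leftMul (P + P') Q = δ.leftMul P Q + δ.leftMul P' Q := by
  rw [leftMul, eval₂_add]; rfl

theorem leftMul_one (P : K[X]) : δ.leftMul P 1 = P := by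
  induction P using Polynomial.induction_on' with
  | add P Q hP hQ => rw [leftMul_add, hP, hQ]
  | monomial n a =>
    rw [leftMul_monomial, shift_pow_one, ← monomial_one_right_eq_X_pow, smul_monomial, smul_eq_mul,
      mul_one]

section Action

variable {δ} {S : Type*} [Ring S] {ψ : K →+* S} {T : S}

theorem eval₂_left_smul (a : K) (Q : K[X]) : (a • Q).eval₂ ψ T = ψ a * Q.eval₂ ψ T := by
  induction Q using Polynomial.induction_on' with
  | add P Q hP hQ => rw [smul_add, eval₂_add, hP, hQ, eval₂_add, mul_add]
  | monomial n b =>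
    rw [smul_monomial, eval₂_monomial, eval₂_monomial, smul_eq_mul, map_mul, mul_assoc]

theorem eval₂_shift (hT : ∀ a, T * ψ a = ψ a * T + ψ (δ.toFun a)) (Q : K[X]) :
    (δ.shift Q).eval₂ ψ T = T * Q.eval₂ ψ T := by
  induction Q using Polynomial.induction_on' with
  | add P Q hP hQ => rw [_root_.map_add, eval₂_add, hP, hQ, eval₂_add, mul_add]
  | monomial n b =>
    rw [shift_monomial, eval₂_add, eval₂_monomial, eval₂_monomial, eval₂_monomial, ← mul_assoc T,
      hT, add_mul, mul_assoc _ T, ← pow_succ']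

/-- A pair `(ψ, T)` satisfying the commutation relation of `K[t;δ]` defines an action of
`K[t;δ]`. -/
theorem eval₂_leftMul (hT : ∀ a, T * ψ a = ψ a * T + ψ (δ.toFun a)) (P Q : K[X]) :
    (δ.leftMul P Q).eval₂ ψ T = P.eval₂ ψ T * Q.eval₂ ψ T := by
  induction P using Polynomial.induction_on' with
  | add P P' hP hP' =>
    rw [leftMul_add, eval₂_add, eval₂_add, add_mul, hP, hP']
  | monomial n a =>
    rw [leftMul_monomial, eval₂_left_smul, eval₂_monomial, mul_assoc]
    congr 1
    induction n with
    | zero => simp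
    | succ n ih => rw [shift_pow_succ_apply, eval₂_shift hT, ih, pow_succ', mul_assoc]

end Action

theorem shift_mul (a : K) : δ.shift * Module.toAddMonoidEnd K K[X] a =
    Module.toAddMonoidEnd K K[X] a * δ.shift + Module.toAddMonoidEnd K K[X] (δ.toFun a) :=
  AddMonoidHom.ext fun P => δ.shift_smul a P

theorem leftMul_leftMul (P Q : K[X]) : δ.leftMul (δ.leftMul P Q) = δ.leftMul P * δ.leftMul Q :=
  eval₂_leftMul δ.shift_mul P Q

theorem coeff_leftMul {P Q : K[X]} {a b : ℕ} (hP : P.natDegree ≤ a) (hQ : Q.natDegree ≤ b) :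
    (δ.leftMul P Q).natDegree ≤ a + b ∧
      (δ.leftMul P Q).coeff (a + b) = P.coeff a * Q.coeff b := by
  have hsum : δ.leftMul P Q = ∑ i ∈ Finset.range (a + 1), P.coeff i • (δ.shift ^ i) Q := by
    rw [leftMul, eval₂_eq_sum_range' _ (Nat.lt_succ_of_le hP)]
    exact AddMonoidHom.finsetSum_apply _ _ _
  have hdeg (i : ℕ) : (P.coeff i • (δ.shift ^ i) Q).natDegree ≤ i + b :=
    (natDegree_smul_le _ _).trans (δ.coeff_shift_pow hQ i).1
  rw [hsum]
  constructor
  · refine natDegree_sum_le_of_forall_le _ _ fun i hi => (hdeg i).trans ?_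
    have := Finset.mem_range.1 hi
    omega
  · rw [finsetSum_coeff, Finset.sum_range_succ, Finset.sum_eq_zero, zero_add, coeff_smul,
      (δ.coeff_shift_pow hQ a).2, smul_eq_mul]
    intro i hi
    refine coeff_eq_zero_of_natDegree_lt ((hdeg i).trans_lt ?_)
    have := Finset.mem_range.1 hi
    omega

theorem degree_leftMul (P Q : K[X]) : (δ.leftMul P Q).degree = P.degree + Q.degree := by
  rcases eq_or_ne P 0 with rfl | hP
  · simp [leftMul]
  rcases eq_or_ne Q 0 with rfl | hQ
  · simp
  obtain ⟨h1, h2⟩ := δ.coeff_leftMul (le_refl P.natDegree) (le_refl Q.natDegree)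
  rw [degree_eq_natDegree hP, degree_eq_natDegree hQ, ← Nat.cast_add]
  refine degree_eq_of_le_of_coeff_ne_zero (natDegree_le_iff_degree_le.1 h1) ?_
  rw [h2]
  exact mul_ne_zero (leadingCoeff_ne_zero.2 hP) (leadingCoeff_ne_zero.2 hQ)

theorem exists_leftMul_add {f : K[X]} (hf : f ≠ 0) (n : ℕ) (P : K[X]) (hP : P.degree < n) :
    ∃ q r, P = δ.leftMul q f + r ∧ r.degree < f.degree := by
  induction n generalizing P with
  | zero =>
    have : P = 0 := by
      rw [← degree_eq_bot]
      exact Nat.WithBot.lt_zero_iff.1 hP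
    exact ⟨0, 0, by simp [this, leftMul], by simpa [bot_lt_iff_ne_bot] using hf⟩
  | succ n ih =>
    rcases lt_or_ge n f.natDegree with h | h
    · refine ⟨0, P, by simp [leftMul], hP.trans_le ?_⟩
      rw [degree_eq_natDegree hf]
      exact_mod_cast h
    · obtain ⟨k, rfl⟩ := Nat.exists_eq_add_of_le' h
      set q := monomial k (P.coeff (k + f.natDegree) / f.leadingCoeff)
      obtain ⟨h1, h2⟩ := δ.coeff_leftMul (natDegree_monomial_le _ : q.natDegree ≤ k)
        (le_refl f.natDegree)
      have hPn : P.natDegree ≤ k + f.natDegree := by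
        refine natDegree_le_iff_coeff_eq_zero.2 fun N hN => coeff_eq_zero_of_degree_lt ?_
        exact hP.trans_le (by exact_mod_cast hN)
      obtain ⟨q', r, h3, h4⟩ := ih (P - δ.leftMul q f) (by
        refine (degree_lt_iff_coeff_zero _ _).2 fun N hN => ?_
        rcases hN.eq_or_lt with rfl | hN
        · rw [coeff_sub, h2, coeff_monomial, if_pos rfl, coeff_natDegree,
            div_mul_cancel₀ _ (leadingCoeff_ne_zero.2 hf), sub_self]
        · rw [coeff_sub, coeff_eq_zero_of_natDegree_lt (hPn.trans_lt hN),
            coeff_eq_zero_of_natDegree_lt (h1.trans_lt hN), sub_self])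
      refine ⟨q' + q, r, ?_, h4⟩
      rw [leftMul_add, sub_eq_iff_eq_add.1 h3]
      abel

/-- The differential polynomial ring `K[t;δ]`, acting on itself by left multiplication. -/
noncomputable def polyRing : Subring (AddMonoid.End K[X]) where
  carrier := Set.range δ.leftMul
  mul_mem' := by
    rintro _ _ ⟨P, rfl⟩ ⟨Q, rfl⟩
    exact ⟨_, δ.leftMul_leftMul P Q⟩
  one_mem' := ⟨1, by simp [leftMul]⟩
  add_mem' := by
    rintro _ _ ⟨P, rfl⟩ ⟨Q, rfl⟩
    exact ⟨P + Q, by simp [leftMul]⟩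
  zero_mem' := ⟨0, by simp [leftMul]⟩
  neg_mem' := by
    rintro _ ⟨P, rfl⟩
    refine ⟨-P, eq_neg_of_add_eq_zero_left ?_⟩
    rw [leftMul, leftMul, ← eval₂_add, neg_add_cancel, eval₂_zero]

/-- The coefficients of a differential polynomial. -/
noncomputable def toPoly : δ.polyRing ≃+ K[X] where
  toFun x := (x : AddMonoid.End K[X]) 1
  invFun P := ⟨δ.leftMul P, P, rfl⟩
  left_inv := by
    rintro ⟨_, P, rfl⟩
    exact Subtype.ext (congrArg δ.leftMul (δ.leftMul_one P))
  right_inv P := δ.leftMul_one P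
  map_add' _ _ := rfl

theorem leftMul_toPoly (x : δ.polyRing) : δ.leftMul (δ.toPoly x) = x :=
  congrArg Subtype.val (δ.toPoly.symm_apply_apply x)

theorem toPoly_mul (x y : δ.polyRing) :
    δ.toPoly (x * y) = δ.leftMul (δ.toPoly x) (δ.toPoly y) := by
  rw [leftMul_toPoly]; rfl

theorem toPoly_symm_monomial (n : ℕ) (a : K) : δ.toPoly.symm (monomial n a) =
    δ.toPoly.symm (C a) * δ.toPoly.symm X ^ n := by
  refine Subtype.ext ?_
  change δ.leftMul (monomial n a) = δ.leftMul (C a) * δ.leftMul X ^ n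
  simp [leftMul]

/-- The coefficient function of a differential polynomial as a finitely supported function. -/
noncomputable def coeffs (x : δ.polyRing) : ℕ →₀ K := (δ.toPoly x).toFinsupp.coeff

theorem toPoly_symm_sum (c : ℕ →₀ K) :
    (c.sum fun n a => δ.toPoly.symm (C a) * δ.toPoly.symm X ^ n) = δ.toPoly.symm ⟨⟨c⟩⟩ := by
  simp_rw [← toPoly_symm_monomial]
  rw [Finsupp.sum, ← _root_.map_sum]
  congr 1
  ext k
  simp [coeff_monomial]

/-- `K[t;δ]` realized as a differential polynomial ring. -/
noncomputable def diffPolyRing : DiffPolyRing K δ δ.polyRing where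
  i :=
    { toFun := fun a => δ.toPoly.symm (C a)
      map_one' := Subtype.ext (by change δ.leftMul 1 = 1; simp [leftMul])
      map_zero' := by simp
      map_add' := by simp
      map_mul' := fun a b => Subtype.ext (by
        change δ.leftMul _ = δ.leftMul _ * δ.leftMul _
        simp [leftMul, -_root_.map_mul, _root_.map_mul (Module.toAddMonoidEnd K K[X])]) }
  t := δ.toPoly.symm X
  coeff := δ.coeffs
  t_mul a := Subtype.ext (by
    change δ.leftMul X * δ.leftMul (C a) = δ.leftMul (C a) * δ.leftMul X + δ.leftMul (C _)
    simpa [leftMul] using δ.shift_mul a)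
  repr' x := by
    refine (δ.toPoly.symm_apply_apply x).symm.trans (δ.toPoly_symm_sum _).symm
  coeff_unique x c h := by
    have h := h.trans (δ.toPoly_symm_sum c)
    rw [h, coeffs, AddEquiv.apply_symm_apply]
  rightDiv f x hf := by
    have hf' : δ.toPoly f ≠ 0 := by simpa using hf
    change ∃! r, (∃ q, x = q * f + r) ∧ (δ.toPoly r).degree < (δ.toPoly f).degree
    obtain ⟨q, r, h1, h2⟩ := δ.exists_leftMul_add hf' ((δ.toPoly x).natDegree + 1) (δ.toPoly x)
      (degree_le_natDegree.trans_lt (by exact_mod_cast Nat.lt_succ_self _))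
    refine ⟨δ.toPoly.symm r, ⟨⟨δ.toPoly.symm q, ?_⟩, by simpa using h2⟩, ?_⟩
    · apply δ.toPoly.injective
      simp [toPoly_mul, h1]
    · rintro r' ⟨⟨q', hq'⟩, hr'⟩
      have h3 : δ.toPoly x = δ.leftMul (δ.toPoly q') (δ.toPoly f) + δ.toPoly r' := by
        rw [hq', _root_.map_add, toPoly_mul]
      have h4 : δ.leftMul (δ.toPoly q' - q) (δ.toPoly f) = r - δ.toPoly r' := by
        rw [h1, ← sub_add_cancel (δ.toPoly q') q, leftMul_add] at h3
        rw [eq_sub_iff_add_eq]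
        refine add_left_cancel (a := δ.leftMul q (δ.toPoly f)) (Eq.trans ?_ h3.symm)
        abel
      have h5 : δ.toPoly q' - q = 0 := by
        by_contra hne
        have h6 := δ.degree_leftMul (δ.toPoly q' - q) (δ.toPoly f)
        rw [h4] at h6
        have h7 : (r - δ.toPoly r').degree < (δ.toPoly f).degree :=
          (degree_sub_le _ _).trans_lt (max_lt h2 hr')
        rw [h6] at h7
        refine absurd h7 (not_lt.2 (le_add_of_nonneg_left ?_))
        exact zero_le_degree_iff.2 hne
      rw [AddEquiv.eq_symm_apply]
      rw [h5, leftMul, eval₂_zero] at h4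
      exact (sub_eq_zero.1 h4.symm).symm

theorem deg_diffPolyRing (x : δ.polyRing) : δ.diffPolyRing.deg x = (δ.toPoly x).degree := rfl

end Der

namespace Der

variable {K : Type} [Field K] (δ : Der K)

/-- A nonzero subspace of a coordinate space which is stable under a derivation contains a
nonzero vector of constants. -/
theorem exists_constants_mem {F ι : Type*} [Field F] [Algebra F K] [Finite ι]
    (hδ : ∀ a : K, δ.toFun a = 0 → ∃ c : F, algebraMap F K c = a)
    (W : Submodule K (ι → K)) (hW : ∀ w ∈ W, (fun j => δ.toFun (w j)) ∈ W) (hne : W ≠ ⊥) :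
    ∃ c : ι → F, c ≠ 0 ∧ (fun j => algebraMap F K (c j)) ∈ W := by
  classical
  have := Fintype.ofFinite ι
  let P (n : ℕ) : Prop := ∃ w ∈ W, w ≠ 0 ∧ (Finset.univ.filter fun j => w j ≠ 0).card = n
  obtain ⟨w₀, hw₀, hw₀'⟩ := W.exists_mem_ne_zero_of_ne_bot hne
  have hP : ∃ n, P n := ⟨_, w₀, hw₀, hw₀', rfl⟩
  obtain ⟨w, hw, hw0, hcard⟩ := Nat.find_spec hP
  obtain ⟨k, hk⟩ := Function.ne_iff.1 hw0
  have hk : w k ≠ 0 := hk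
  set u : ι → K := (w k)⁻¹ • w with hu
  have huW : u ∈ W := W.smul_mem _ hw
  have huk : u k = 1 := by simp [hu, hk]
  have hδu : (fun j => δ.toFun (u j)) = 0 := by
    by_contra hcon
    refine Nat.find_min hP (m := (Finset.univ.filter fun j => δ.toFun (u j) ≠ 0).card) ?_
      ⟨_, hW u huW, hcon, rfl⟩
    rw [← hcard]
    refine Finset.card_lt_card ⟨?_, ?_⟩
    · intro j hj
      simp only [Finset.mem_filter, Finset.mem_univ, true_and] at hj ⊢
      rintro hwj
      exact hj (by simp [hu, hwj, δ.map_zero])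
    · intro hsub
      have := hsub (show k ∈ _ by simpa using hk)
      simp [huk, δ.map_one] at this
  choose c hc using fun j => hδ (u j) (congrFun hδu j)
  refine ⟨c, fun h => ?_, by simpa [hc] using huW⟩
  have := hc k
  simp [h, huk] at this

section Coordinatewise

variable {A ι : Type*} [Ring A] [Algebra K A] [Fintype ι] (B : Module.Basis ι K A)

/-- The extension of a derivation to a vector space, applied coordinatewise with respect to
a basis. -/
noncomputable def coordwise : A →+ A :=
  AddMonoidHom.mk' (fun X => ∑ j, δ.toFun (B.repr X j) • B j) fun X Y => by
    simp [δ.map_add', add_smul, Finset.sum_add_distrib]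

theorem coordwise_apply (X : A) : δ.coordwise B X = ∑ j, δ.toFun (B.repr X j) • B j := rfl

theorem repr_coordwise (X : A) (j : ι) :
    B.repr (δ.coordwise B X) j = δ.toFun (B.repr X j) := by
  classical
  simp [coordwise_apply, Finsupp.single_apply]

theorem coordwise_smul (a : K) (X : A) :
    δ.coordwise B (a • X) = a • δ.coordwise B X + δ.toFun a • X := by
  apply B.repr.injective
  ext j
  simp [repr_coordwise, δ.leibniz']

theorem coordwise_mul (hB : ∀ i j, δ.coordwise B (B i * B j) = 0) (X Y : A) :
    δ.coordwise B (X * Y) = δ.coordwise B X * Y + X * δ.coordwise B Y := by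
  have hB0 (i : ι) : δ.coordwise B (B i) = 0 := by
    classical
    apply B.repr.injective
    ext j
    by_cases h : i = j <;> simp [repr_coordwise, h, δ.map_one, δ.map_zero]
  have hX := B.mem_span X
  have hY := B.mem_span Y
  induction hX using Submodule.span_induction with
  | zero => simp
  | add X X' _ _ h h' => rw [add_mul, map_add, h, h', map_add]; noncomm_ring
  | smul a X _ h =>
    rw [smul_mul_assoc, coordwise_smul, h, coordwise_smul, add_mul, smul_add, smul_mul_assoc,
      smul_mul_assoc, smul_mul_assoc]
    abel
  | mem X hX =>
    obtain ⟨i, rfl⟩ := hX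
    rw [hB0, zero_mul, zero_add]
    induction hY using Submodule.span_induction with
    | zero => simp
    | add Y Y' _ _ h h' => rw [mul_add, map_add, h, h', map_add, mul_add]
    | smul a Y _ h =>
      rw [mul_smul_comm, coordwise_smul, h, coordwise_smul, mul_add, mul_smul_comm,
        mul_smul_comm]
    | mem Y hY =>
      obtain ⟨j, rfl⟩ := hY
      rw [hB, hB0, mul_zero]

end Coordinatewise

/-- A simple module over `K[t;δ]` with endomorphism ring the opposite of `E`; the element `t`
acts by `T`. -/
structure SimpleAction (F E V : Type) [Field F] [Algebra F K] [DivisionRing E] [Algebra F E]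
    [AddCommGroup V] [Module K V] where
  T : AddMonoid.End V
  r : E → V →ₗ[K] V
  T_smul : ∀ (a : K) (v : V), T (a • v) = a • T v + δ.toFun a • v
  T_r : ∀ d v, T (r d v) = r d (T v)
  r_mul : ∀ d d' v, r (d * d') v = r d' (r d v)
  r_add : ∀ d d' v, r (d + d') v = r d v + r d' v
  r_algebraMap : ∀ (c : F) v, r (algebraMap F E c) v = algebraMap F K c • v
  eq_top : ∀ W : Submodule K V, (∀ w ∈ W, T w ∈ W) → W ≠ ⊥ → W = ⊤
  exists_r : ∀ h : V →ₗ[K] V, (∀ v, T (h v) = h (T v)) → ∃ d, h = r d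

open TensorProduct in
theorem nonempty_simpleAction {F E n : Type} [Field F] [Algebra F K] [DivisionRing E]
    [Algebra F E] [FiniteDimensional F E] [Fintype n] [DecidableEq n] [Nonempty n]
    (hδ : δ.HasConstants F) (Ψ : K ⊗[F] E ≃ₐ[K] Matrix n n K) :
    Nonempty (δ.SimpleAction F E (n → K)) := by
  let y := Module.finBasis F E
  let B := (Algebra.TensorProduct.basis K y).map Ψ.toLinearEquiv
  let ρ (d : E) : Matrix n n K := Ψ (1 ⊗ₜ d)
  have ρ_mul (d d' : E) : ρ (d * d') = ρ d * ρ d' := by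
    simp [ρ, ← map_mul]
  have ρ_add (d d' : E) : ρ (d + d') = ρ d + ρ d' := by
    simp [ρ, TensorProduct.tmul_add]
  have ρ_one : ρ 1 = 1 := _root_.map_one Ψ
  have ρ_alg (c : F) : ρ (algebraMap F E c) = algebraMap F K c • 1 := by
    have h : (1 : K) ⊗ₜ[F] algebraMap F E c = algebraMap F K c • (1 : K ⊗[F] E) := by
      rw [Algebra.algebraMap_eq_smul_one, TensorProduct.tmul_smul, algebraMap_smul]; rfl
    rw [← ρ_one]
    simp only [ρ, h]
    exact map_smul Ψ _ _
  have hBρ (c : Fin (Module.finrank F E) → F) :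
      ∑ j, algebraMap F K (c j) • B j = ρ (∑ j, c j • y j) := by
    simp only [B, ρ, TensorProduct.tmul_sum, _root_.map_sum, Module.Basis.map_apply]
    refine Finset.sum_congr rfl fun j _ => ?_
    rw [Algebra.TensorProduct.basis_apply, TensorProduct.tmul_smul,
      ← algebraMap_smul K (c j) ((1 : K) ⊗ₜ[F] y j)]
    exact (map_smul Ψ _ _).symm
  have hδ0 (c : F) : δ.toFun (algebraMap F K c) = 0 := (hδ _).2 ⟨c, rfl⟩
  have hBr (c : Fin (Module.finrank F E) → F) (j) :
      B.repr (∑ j, algebraMap F K (c j) • B j) j = algebraMap F K (c j) := by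
    rw [B.repr_sum_self]
  have hρ0 (d : E) : δ.coordwise B (ρ d) = 0 := by
    rw [← y.sum_repr d, ← hBρ, coordwise_apply]
    simp only [hBr, hδ0, zero_smul, Finset.sum_const_zero]
  have hB (j) : B j = ρ (y j) := by simp [B, ρ]
  have leib := δ.coordwise_mul B fun i j => by rw [hB, hB, ← ρ_mul, hρ0]
  obtain ⟨o⟩ := ‹Nonempty n›
  let e : n → K := Pi.single o 1
  let T : AddMonoid.End (n → K) :=
    AddMonoidHom.mk' (fun v => δ.coordwise B (Matrix.vecMulVec e v) o) fun v w => by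
      rw [Matrix.vecMulVec_add, map_add]; rfl
  have Tmul (v : n → K) (X : Matrix n n K) :
      T (Matrix.vecMul v X) = Matrix.vecMul (T v) X + Matrix.vecMul v (δ.coordwise B X) := by
    change δ.coordwise B _ o = _
    rw [← Matrix.vecMulVec_mul, leib]
    refine congrArg₂ (· + ·) (Matrix.mul_apply_eq_vecMul (δ.coordwise B _) X o) ?_
    rw [Matrix.vecMulVec_mul]
    ext j
    simp [Matrix.vecMulVec_apply, e]
  refine ⟨T, fun d => Matrix.vecMulLinear (ρ d), ?_, ?_, ?_, ?_, ?_, ?_, ?_⟩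
  · intro a v
    change δ.coordwise B _ o = a • δ.coordwise B _ o + _
    rw [Matrix.vecMulVec_smul, coordwise_smul]
    ext j
    simp [Matrix.vecMulVec_apply, e]
  · intro d v
    simp [Tmul, hρ0]
  · intro d d' v
    simp [ρ_mul]
  · intro d d' v
    simp [ρ_add]
  · intro c v
    simp [ρ_alg]
  · intro W hW hne
    let J : Submodule K (Fin (Module.finrank F E) → K) :=
      { carrier := {b | ∀ v, Matrix.vecMul v (∑ j, b j • B j) ∈ W}
        zero_mem' := fun v => by simp
        add_mem' := fun {b b'} h h' v => by
          simpa [add_smul, Finset.sum_add_distrib, Matrix.vecMul_add] using W.add_mem (h v) (h' v)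
        smul_mem' := fun a b h v => by
          simpa [mul_smul, ← Finset.smul_sum, Matrix.vecMul_smul] using W.smul_mem a (h v) }
    have hJ (b) : b ∈ J ↔ ∀ v, Matrix.vecMul v (∑ j, b j • B j) ∈ W := Iff.rfl
    obtain ⟨c, hc0, hc⟩ := δ.exists_constants_mem (fun a => (hδ a).1) J (fun b hb v => by
      have h := Tmul v (∑ j, b j • B j)
      rw [coordwise_apply] at h
      simp only [B.repr_sum_self] at h
      rw [← sub_eq_iff_eq_add'.2 h]
      exact W.sub_mem (hW _ (hb v)) (hb _)) (by
      obtain ⟨w, hw, hw0⟩ := W.exists_mem_ne_zero_of_ne_bot hne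
      have hmem : (B.repr (Matrix.vecMulVec 1 w) : _ → K) ∈ J := fun v => by
        rw [B.sum_repr, Matrix.vecMul_vecMulVec]
        exact W.smul_mem _ hw
      intro hbot
      rw [hbot, Submodule.mem_bot] at hmem
      have h0 : Matrix.vecMulVec (1 : n → K) w = 0 := by
        rw [← B.sum_repr (Matrix.vecMulVec 1 w), hmem]; simp
      refine hw0 (funext fun j => ?_)
      simpa [Matrix.vecMulVec_apply] using congrFun (congrFun h0 o) j)
    rw [hJ] at hc
    simp only [hBρ] at hc
    set d := ∑ j, c j • y j with hd
    have hd0 : d ≠ 0 := fun h =>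
      hc0 (funext (Fintype.linearIndependent_iff.1 y.linearIndependent c h))
    rw [Submodule.eq_top_iff']
    intro v
    simpa [← ρ_mul, inv_mul_cancel₀ hd0, ρ_one] using hc (Matrix.vecMul v (ρ d⁻¹))
  · intro h hh
    set X := (LinearMap.toMatrix' h).transpose
    have hX (v) : h v = Matrix.vecMul v X := by
      rw [Matrix.vecMul_transpose, LinearMap.toMatrix'_mulVec]
    have hX0 : δ.coordwise B X = 0 := by
      ext i j
      have := hh (Pi.single i 1)
      rw [hX, hX, Tmul, add_eq_left] at this
      simpa using congrFun this j
    choose c hc using fun j => (hδ (B.repr X j)).1 (by rw [← repr_coordwise, hX0]; simp)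
    refine ⟨∑ j, c j • y j, LinearMap.ext fun v => ?_⟩
    rw [hX, ← hBρ]
    simp only [hc, B.sum_repr]
    rfl

end Der

namespace Der

open Polynomial

variable {K : Type} [Field K] {δ : Der K}

/-- A nonzero differential operator of order `n ≥ 1` cannot vanish identically if the dimension
over the field of constants exceeds `n`. -/
theorem finrank_le_of_eval₂_eq_zero {F : Type} [Field F] [Algebra F K] [FiniteDimensional F K]
    (hδ : δ.HasConstants F) {P : K[X]} (hP0 : 0 < P.natDegree)
    (hP : P.eval₂ (Module.toAddMonoidEnd K K) δ.toEnd = 0) :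
    Module.finrank F K ≤ P.natDegree := by
  by_contra! hlt
  have hP_ne : P ≠ 0 := by
    rintro rfl
    simp at hP0
  set m := P.natDegree with hm
  let Δ : AddMonoid.End K := δ.toEnd
  have hΔ (i : ℕ) (a : K) : δ.toFun ((Δ ^ i) a) = (Δ ^ (i + 1)) a := by rw [pow_succ']; rfl
  have hlead : P.coeff m ≠ 0 := by
    rwa [hm, coeff_natDegree, leadingCoeff_ne_zero]
  have hrel (a : K) : P.coeff m * (Δ ^ m) a =
      -∑ i ∈ Finset.range m, P.coeff i * (Δ ^ i) a := by
    have h := DFunLike.congr_fun hP a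
    rw [eval₂_eq_sum_range, Finset.sum_range_succ] at h
    refine eq_neg_of_add_eq_zero_right (Eq.trans ?_ h)
    refine congrArg₂ (· + ·) ?_ rfl
    exact (AddMonoidHom.finsetSum_apply (M := K) (N := K)
      (fun i => (Module.toAddMonoidEnd K K (P.coeff i) * Δ ^ i : AddMonoid.End K)) _ a).symm
  let y := Module.finBasis F K
  let L : (Fin (Module.finrank F K) → K) →ₗ[K] (Fin m → K) :=
    LinearMap.pi fun i => ∑ j, (Δ ^ (i : ℕ)) (y j) • LinearMap.proj j
  have hL (b i) : L b i = ∑ j, b j * (Δ ^ (i : ℕ)) (y j) := by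
    simp [L, mul_comm]
  have hker : LinearMap.ker L ≠ ⊥ := LinearMap.ker_ne_bot_of_finrank_lt (by simpa using hlt)
  obtain ⟨c, hc0, hc⟩ := δ.exists_constants_mem (fun a => (hδ a).1) _ (fun b hb => by
    have hb (i : ℕ) (hi : i < m) : ∑ j, b j * (Δ ^ i) (y j) = 0 := by
      rw [← hL b ⟨i, hi⟩, LinearMap.mem_ker.1 hb]; rfl
    rw [LinearMap.mem_ker]
    ext i
    rw [hL, Pi.zero_apply]
    have h := congrArg δ.toFun (hb i i.2)
    simp only [δ.map_zero, δ.map_sum, δ.leibniz', Finset.sum_add_distrib, hΔ] at h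
    have h' : ∑ j, b j * (Δ ^ ((i : ℕ) + 1)) (y j) = 0 := by
      rcases (Nat.succ_le_of_lt i.2).lt_or_eq with hi | hi
      · exact hb _ hi
      · rw [Nat.succ_eq_add_one] at hi
        rw [hi]
        refine (mul_eq_zero.1 ?_).resolve_left hlead
        simp only [Finset.mul_sum, mul_left_comm _ (b _), hrel]
        simp only [mul_neg, Finset.sum_neg_distrib, Finset.mul_sum, neg_eq_zero]
        rw [Finset.sum_comm]
        refine Finset.sum_eq_zero fun k hk => ?_
        simp only [mul_left_comm (b _), ← Finset.mul_sum, hb k (Finset.mem_range.1 hk), mul_zero]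
    rwa [h', zero_add] at h) hker
  have h := congrFun (LinearMap.mem_ker.1 hc) ⟨0, hP0⟩
  rw [hL] at h
  refine hc0 (funext (Fintype.linearIndependent_iff.1 y.linearIndependent c ?_))
  simpa [Algebra.smul_def] using h

namespace SimpleAction

variable {F E V : Type} [Field F] [Algebra F K] [DivisionRing E] [Algebra F E]
  [AddCommGroup V] [Module K V] (S : δ.SimpleAction F E V)

/-- The action of a differential polynomial, given by its coefficients. -/
noncomputable def act (P : K[X]) : AddMonoid.End V := P.eval₂ (Module.toAddMonoidEnd K V) S.T

theorem act_leftMul (P Q : K[X]) : S.act (δ.leftMul P Q) = S.act P * S.act Q :=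
  eval₂_leftMul (ψ := Module.toAddMonoidEnd K V) (T := S.T)
    (fun a => AddMonoidHom.ext fun v => S.T_smul a v) P Q

theorem act_leftMul_apply (P Q : K[X]) (v : V) :
    S.act (δ.leftMul P Q) v = S.act P (S.act Q v) := by
  rw [act_leftMul]; rfl

theorem act_add (P Q : K[X]) (v : V) : S.act (P + Q) v = S.act P v + S.act Q v := by
  rw [act, eval₂_add]; rfl

theorem act_smul (a : K) (P : K[X]) (v : V) : S.act (a • P) v = a • S.act P v := by
  rw [act, eval₂_left_smul]; rfl

theorem act_C (a : K) (v : V) : S.act (C a) v = a • v := by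
  rw [act, eval₂_C]; rfl

theorem act_one (v : V) : S.act 1 v = v := by
  rw [act, eval₂_one]; rfl

theorem act_X (v : V) : S.act X v = S.T v := by
  rw [act, eval₂_X]

theorem act_r (P : K[X]) (d : E) (v : V) : S.act P (S.r d v) = S.r d (S.act P v) := by
  induction P using Polynomial.induction_on generalizing v with
  | C a => rw [act_C, act_C, map_smul]
  | add P Q hP hQ => rw [act_add, act_add, hP, hQ, map_add]
  | monomial n a ih =>
    have h (u : V) : S.act (C a * X ^ (n + 1)) u = S.act (C a * X ^ n) (S.T u) := by
      simp only [act, C_mul_X_pow_eq_monomial, eval₂_monomial]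
      rw [pow_succ]
      rfl
    rw [h, h, S.T_r, ih]

/-- The evaluation map of the action at a vector. -/
noncomputable def eval (w : V) : K[X] →ₗ[K] V where
  toFun P := S.act P w
  map_add' P Q := S.act_add P Q w
  map_smul' a P := S.act_smul a P w

theorem eval_apply (w : V) (P : K[X]) : S.eval w P = S.act P w := rfl

theorem finrank_le_degree {w : V} (hw : w ≠ 0) {P : K[X]} (hP : P ≠ 0) (hPw : S.act P w = 0) :
    (Module.finrank K V : WithBot ℕ) ≤ P.degree := by
  have htop : LinearMap.range (S.eval w) = ⊤ := by
    refine S.eq_top _ ?_ ?_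
    · rintro _ ⟨Q, rfl⟩
      refine ⟨δ.leftMul X Q, ?_⟩
      rw [eval_apply, act_leftMul_apply, act_X, eval_apply]
    · intro hbot
      have : w ∈ LinearMap.range (S.eval w) := ⟨1, S.act_one w⟩
      rw [hbot] at this
      exact hw this
  have hsurj : Function.Surjective ((S.eval w).domRestrict (degreeLT K P.natDegree)) := by
    intro v
    obtain ⟨Q, rfl⟩ := LinearMap.range_eq_top.1 htop v
    obtain ⟨q, r, h1, h2⟩ := δ.exists_leftMul_add hP (Q.natDegree + 1) Q
      (degree_le_natDegree.trans_lt (by exact_mod_cast Nat.lt_succ_self _))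
    refine ⟨⟨r, mem_degreeLT.2 (h2.trans_le degree_le_natDegree)⟩, ?_⟩
    rw [LinearMap.domRestrict_apply, h1, eval_apply, eval_apply, act_add, act_leftMul_apply,
      hPw, _root_.map_zero, zero_add]
  have := (degreeLTEquiv K P.natDegree).symm.finiteDimensional
  have h := LinearMap.finrank_le_finrank_of_surjective hsurj
  rw [(degreeLTEquiv K P.natDegree).finrank_eq, Module.finrank_fin_fun] at h
  rw [degree_eq_natDegree hP]
  exact_mod_cast h

theorem exists_act_eq [FiniteDimensional K V] {w : V} (hw : w ≠ 0) (v : V) :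
    ∃ P : K[X], P.degree < Module.finrank K V ∧ S.act P w = v := by
  set m := Module.finrank K V with hm
  have := (degreeLTEquiv K m).symm.finiteDimensional
  have hinj : Function.Injective ((S.eval w).domRestrict (degreeLT K m)) := by
    rw [injective_iff_map_eq_zero]
    rintro ⟨P, hP⟩ h
    by_contra hne
    have hP0 : P ≠ 0 := fun h0 => hne (Subtype.ext h0)
    exact absurd (mem_degreeLT.1 hP) (not_lt.2 (S.finrank_le_degree hw hP0 h))
  have hdim : Module.finrank K (degreeLT K m) = Module.finrank K V := by
    rw [(degreeLTEquiv K m).finrank_eq, Module.finrank_fin_fun]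
  obtain ⟨⟨P, hP⟩, h⟩ := (LinearMap.injective_iff_surjective_of_finrank_eq_finrank hdim).1 hinj v
  exact ⟨P, mem_degreeLT.1 hP, h⟩

theorem exists_act_smul_ne_zero [FiniteDimensional F K] (hδ : δ.HasConstants F)
    (hV : 0 < Module.finrank K V) (hlt : Module.finrank K V < Module.finrank F K)
    {w : V} (hw : w ≠ 0) {P : K[X]} (hP : P.degree = Module.finrank K V) :
    ∃ a : K, S.act P (a • w) ≠ 0 := by
  by_contra! hall
  set m := Module.finrank K V
  have hdeg : P.natDegree = m := natDegree_eq_of_degree_eq_some hP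
  have hcomm (a : K) : δ.leftMul P (C a) = a • P := by
    by_contra hne
    have hne := sub_ne_zero.2 hne
    have hkill : S.eval w (δ.leftMul P (C a) - a • P) = 0 := by
      rw [map_sub, eval_apply, map_smul, eval_apply, act_leftMul_apply, act_C, hall]
      simpa using congrArg (a • ·) (hall 1)
    refine absurd (S.finrank_le_degree hw hne hkill) (not_le.2 ?_)
    obtain ⟨h1, h2⟩ := δ.coeff_leftMul hdeg.le (natDegree_C a).le
    refine (degree_lt_iff_coeff_zero _ _).2 fun N hN => ?_
    rcases hN.eq_or_lt with rfl | hN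
    · simpa [mul_comm, sub_eq_zero] using h2
    · rw [coeff_sub, coeff_eq_zero_of_natDegree_lt (h1.trans_lt hN), coeff_smul,
        coeff_eq_zero_of_natDegree_lt (hdeg.trans_lt hN), smul_zero, sub_zero]
  let ev (Q : K[X]) : AddMonoid.End K :=
    Q.eval₂ (Module.toAddMonoidEnd K K) δ.toEnd
  have hev (a : K) : ev P a = a * ev P 1 := by
    have h := eval₂_leftMul (δ := δ) (ψ := Module.toAddMonoidEnd K K)
      (T := δ.toEnd) (fun a => AddMonoidHom.ext fun b => by
        change δ.toFun (a * b) = a * δ.toFun b + δ.toFun a * b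
        exact δ.leibniz' a b) P (C a)
    rw [hcomm, eval₂_left_smul, eval₂_C] at h
    have h := (DFunLike.congr_fun h 1).symm
    change ev P (a * 1) = a * ev P 1 at h
    rwa [mul_one] at h
  have hz : ev (P - C (ev P 1)) = 0 := by
    refine AddMonoidHom.ext fun a => ?_
    simp only [ev, eval₂_sub, eval₂_C]
    change ev P a - ev P 1 * a = 0
    rw [hev, mul_comm, sub_self]
  have hnd : (P - C (ev P 1)).natDegree = m := by rw [natDegree_sub_C, hdeg]
  have := finrank_le_of_eval₂_eq_zero hδ (by rwa [hnd]) hz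
  omega

end SimpleAction

end Der

namespace Der

open Polynomial

variable {K F E V : Type} [Field K] {δ : Der K} [Field F] [Algebra F K] [DivisionRing E]
  [Algebra F E] [AddCommGroup V] [Module K V]

namespace SimpleAction

variable (S : δ.SimpleAction F E V)

theorem r_zero (v : V) : S.r 0 v = 0 := by simpa using S.r_algebraMap 0 v

theorem r_one (v : V) : S.r 1 v = v := by simpa using S.r_algebraMap 1 v

theorem r_inv_r {d : E} (hd : d ≠ 0) (v : V) : S.r d⁻¹ (S.r d v) = v := by
  rw [← S.r_mul, mul_inv_cancel₀ hd, S.r_one]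

theorem r_injective {v : V} (hv : v ≠ 0) : Function.Injective fun d => S.r d v := by
  intro d d' (h : S.r d v = S.r d' v)
  by_contra hne
  refine hv ?_
  have h0 : S.r (d - d') v = 0 := by
    have := S.r_add (d - d') d' v
    rwa [sub_add_cancel, h, right_eq_add] at this
  rw [← S.r_inv_r (sub_ne_zero.2 hne) v, h0, _root_.map_zero]

/-- The action of `K[t;δ]` on the module `V`. -/
noncomputable def Φ (x : δ.polyRing) : AddMonoid.End V := S.act (δ.toPoly x)

theorem Φ_mul (x y : δ.polyRing) (v : V) : S.Φ (x * y) v = S.Φ x (S.Φ y v) := by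
  rw [Φ, toPoly_mul]; exact S.act_leftMul_apply _ _ v

theorem Φ_add (x y : δ.polyRing) (v : V) : S.Φ (x + y) v = S.Φ x v + S.Φ y v := by
  rw [Φ, _root_.map_add]; exact S.act_add _ _ v

theorem Φ_sub (x y : δ.polyRing) (v : V) : S.Φ (x - y) v = S.Φ x v - S.Φ y v := by
  rw [eq_sub_iff_add_eq, ← Φ_add, sub_add_cancel]

theorem Φ_i (a : K) (v : V) : S.Φ (δ.diffPolyRing.i a) v = a • v := by
  have : δ.toPoly (δ.diffPolyRing.i a) = C a := δ.toPoly.apply_symm_apply _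
  rw [Φ, this]; exact S.act_C a v

theorem Φ_one (v : V) : S.Φ 1 v = v := by
  simpa using S.Φ_i 1 v

theorem toPoly_t : δ.toPoly δ.diffPolyRing.t = X := δ.toPoly.apply_symm_apply _

theorem Φ_t (v : V) : S.Φ δ.diffPolyRing.t v = S.T v := by
  rw [Φ, toPoly_t]; exact S.act_X v

theorem Φ_r (x : δ.polyRing) (d : E) (v : V) : S.Φ x (S.r d v) = S.r d (S.Φ x v) :=
  S.act_r _ d v

end SimpleAction

theorem deg_mul (x y : δ.polyRing) :
    δ.diffPolyRing.deg (x * y) = δ.diffPolyRing.deg x + δ.diffPolyRing.deg y := by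
  simp only [deg_diffPolyRing, toPoly_mul, degree_leftMul]

theorem deg_one : δ.diffPolyRing.deg 1 = 0 := by
  rw [← _root_.map_one δ.diffPolyRing.i]
  exact (congrArg degree (δ.toPoly.apply_symm_apply _)).trans (degree_C one_ne_zero)

theorem deg_i_le (a : K) : δ.diffPolyRing.deg (δ.diffPolyRing.i a) ≤ 0 :=
  (congrArg degree (δ.toPoly.apply_symm_apply _)).trans_le degree_C_le

theorem deg_t_pow (n : ℕ) : δ.diffPolyRing.deg (δ.diffPolyRing.t ^ n) = n := by
  induction n with
  | zero => simpa using deg_one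
  | succ n ih =>
    rw [pow_succ, deg_mul, ih, deg_diffPolyRing, SimpleAction.toPoly_t, degree_X]
    rfl

theorem eq_i_of_deg_le {x : δ.polyRing} (hx : δ.diffPolyRing.deg x ≤ 0) :
    ∃ a, δ.diffPolyRing.i a = x := by
  refine ⟨(δ.toPoly x).coeff 0, ?_⟩
  rw [← δ.toPoly.symm_apply_apply x, eq_C_of_degree_le_zero hx]
  simp [diffPolyRing]

theorem deg_sub_lt {x y : δ.polyRing} {n : WithBot ℕ} (hx : δ.diffPolyRing.deg x < n)
    (hy : δ.diffPolyRing.deg y < n) : δ.diffPolyRing.deg (x - y) < n := by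
  rw [sub_eq_add_neg]
  exact δ.diffPolyRing.deg_add_lt hx (by rwa [δ.diffPolyRing.deg_neg])

end Der

namespace Der

open Polynomial

variable {K F E V : Type} [Field K] {δ : Der K} [Field F] [Algebra F K] [DivisionRing E]
  [Algebra F E] [AddCommGroup V] [Module K V]

namespace SimpleAction

/-- A differential polynomial `f` of degree `dim V` annihilating a nonzero vector `v₀`, so that
`V` is isomorphic to `K[t;δ]/K[t;δ]f`. -/
structure Annihilator (S : δ.SimpleAction F E V) (m : ℕ) where
  f : δ.polyRing
  v₀ : V
  finrank_eq : Module.finrank K V = m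
  deg_f : δ.diffPolyRing.deg f = m
  v₀_ne : v₀ ≠ 0
  Φ_f : S.Φ f v₀ = 0

variable {S : δ.SimpleAction F E V} {m : ℕ}

theorem nonempty_annihilator [FiniteDimensional K V] (hV : Module.finrank K V = m)
    (hm : 2 ≤ m) : Nonempty (S.Annihilator m) := by
  have : Nontrivial V := Module.nontrivial_of_finrank_pos (R := K) (by omega)
  obtain ⟨v, hv⟩ := exists_ne (0 : V)
  obtain ⟨P, hP, hPv⟩ := S.exists_act_eq hv (S.act (X ^ m) v)
  refine ⟨⟨δ.toPoly.symm (X ^ m - P), v, hV, ?_, hv, ?_⟩⟩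
  · rw [deg_diffPolyRing, AddEquiv.apply_symm_apply, degree_sub_eq_left_of_degree_lt, degree_X_pow]
    rwa [degree_X_pow, ← hV]
  · change S.act (δ.toPoly (δ.toPoly.symm (X ^ m - P))) v = 0
    rw [AddEquiv.apply_symm_apply]
    have h := S.act_add (X ^ m - P) P v
    rwa [sub_add_cancel, hPv, right_eq_add] at h

namespace Annihilator

variable (A : S.Annihilator m)

include A in
theorem le_deg {w : V} (hw : w ≠ 0) {x : δ.polyRing} (hx : x ≠ 0) (hxw : S.Φ x w = 0) :
    (m : WithBot ℕ) ≤ δ.diffPolyRing.deg x := by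
  rw [← A.finrank_eq, deg_diffPolyRing]
  exact S.finrank_le_degree hw (by simpa using hx) hxw

include A in
theorem eq_of_Φ_eq {w : V} (hw : w ≠ 0) {x y : δ.polyRing} (hx : x ∈ δ.diffPolyRing.SfSet m)
    (hy : y ∈ δ.diffPolyRing.SfSet m) (h : S.Φ x w = S.Φ y w) : x = y := by
  by_contra hne
  refine absurd (A.le_deg hw (sub_ne_zero.2 hne) ?_) (not_le.2 (deg_sub_lt hx hy))
  rw [S.Φ_sub, h, sub_self]

include A in
theorem exists_Φ_eq [FiniteDimensional K V] {w : V} (hw : w ≠ 0) (v : V) :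
    ∃ x ∈ δ.diffPolyRing.SfSet m, S.Φ x w = v := by
  obtain ⟨P, hP, hPw⟩ := S.exists_act_eq hw v
  refine ⟨δ.toPoly.symm P, ?_, ?_⟩
  · change δ.diffPolyRing.deg _ < _
    rwa [deg_diffPolyRing, AddEquiv.apply_symm_apply, ← A.finrank_eq]
  · change S.act (δ.toPoly (δ.toPoly.symm P)) w = v
    rwa [AddEquiv.apply_symm_apply]

theorem f_ne_zero : A.f ≠ 0 := by
  intro h
  have := A.deg_f
  rw [h, DiffPolyRing.deg_zero] at this
  exact absurd this (by simp)

theorem modr_spec (x : δ.polyRing) : δ.diffPolyRing.modr A.f x ∈ δ.diffPolyRing.SfSet m ∧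
    S.Φ (δ.diffPolyRing.modr A.f x) A.v₀ = S.Φ x A.v₀ := by
  have h := δ.diffPolyRing.rightDiv A.f x A.f_ne_zero
  rw [DiffPolyRing.modr, dif_pos h]
  obtain ⟨⟨⟨q, hq⟩, hdeg⟩, -⟩ := h.choose_spec
  refine ⟨hdeg.trans_eq A.deg_f, ?_⟩
  conv_rhs => rw [hq]
  rw [S.Φ_add, S.Φ_mul, A.Φ_f, _root_.map_zero, zero_add]

theorem pmul_mem (x y : δ.polyRing) :
    δ.diffPolyRing.pmul A.f x y ∈ δ.diffPolyRing.SfSet m := (A.modr_spec _).1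

theorem Φ_pmul (x y : δ.polyRing) :
    S.Φ (δ.diffPolyRing.pmul A.f x y) A.v₀ = S.Φ x (S.Φ y A.v₀) := by
  rw [← S.Φ_mul]; exact (A.modr_spec _).2

theorem pmul_eq {x y : δ.polyRing} (h : x * y ∈ δ.diffPolyRing.SfSet m) :
    δ.diffPolyRing.pmul A.f x y = x * y :=
  A.eq_of_Φ_eq A.v₀_ne (A.pmul_mem _ _) h (by rw [A.Φ_pmul, S.Φ_mul])

theorem mul_i_mem {x : δ.polyRing} (hx : x ∈ δ.diffPolyRing.SfSet m) (a : K) :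
    x * δ.diffPolyRing.i a ∈ δ.diffPolyRing.SfSet m := by
  change δ.diffPolyRing.deg _ < _
  rw [deg_mul]
  exact (add_le_add_right (deg_i_le a) _).trans_lt (by rw [add_zero]; exact hx)

theorem i_mul_mem {x : δ.polyRing} (hx : x ∈ δ.diffPolyRing.SfSet m) (a : K) :
    δ.diffPolyRing.i a * x ∈ δ.diffPolyRing.SfSet m := δ.diffPolyRing.deg_i_mul_lt _ hx

theorem i_mem (hm : 2 ≤ m) (a : K) : δ.diffPolyRing.i a ∈ δ.diffPolyRing.SfSet m :=
  (deg_i_le a).trans_lt (by exact_mod_cast (show 0 < m by omega))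

theorem one_mem (hm : 2 ≤ m) : (1 : δ.polyRing) ∈ δ.diffPolyRing.SfSet m := by
  rw [← _root_.map_one δ.diffPolyRing.i]
  exact i_mem hm 1

theorem t_pow_mem {n : ℕ} (hn : n < m) : δ.diffPolyRing.t ^ n ∈ δ.diffPolyRing.SfSet m := by
  change δ.diffPolyRing.deg _ < _
  rw [deg_t_pow]
  exact_mod_cast hn

theorem petitUnital (hm : 2 ≤ m) : δ.diffPolyRing.PetitUnital A.f m := by
  refine ⟨one_mem hm, fun x hx => ?_⟩
  rw [A.pmul_eq (by simpa), A.pmul_eq (by simpa), one_mul, mul_one]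
  exact ⟨rfl, rfl⟩

include A in
theorem Φ_ne_zero {w : V} (hw : w ≠ 0) {x : δ.polyRing} (hx : x ∈ δ.diffPolyRing.SfSet m)
    (hx0 : x ≠ 0) : S.Φ x w ≠ 0 := fun h => absurd (A.le_deg hw hx0 h) (not_le.2 hx)

theorem irred (hm : 2 ≤ m) : δ.diffPolyRing.Irred A.f := by
  constructor
  · intro h
    obtain ⟨g, hg⟩ := h.exists_right_inv
    have h := congrArg δ.diffPolyRing.deg hg
    rw [deg_mul, A.deg_f, deg_one] at h
    cases hd : δ.diffPolyRing.deg g with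
    | bot => simp [hd] at h
    | coe n =>
      replace hd : δ.diffPolyRing.deg g = (n : ℕ) := hd
      rw [hd] at h
      have : m + n = 0 := by exact_mod_cast h
      omega
  · rintro ⟨g, h, hgh, hg, hh⟩
    rw [A.deg_f] at hg hh
    have hg0 : g ≠ 0 := by
      rintro rfl
      exact A.f_ne_zero (by simp [hgh])
    have hh0 : h ≠ 0 := by
      rintro rfl
      exact A.f_ne_zero (by simp [hgh])
    refine A.Φ_ne_zero (A.Φ_ne_zero A.v₀_ne hh hh0) hg hg0 ?_
    rw [← S.Φ_mul, ← hgh, A.Φ_f]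

theorem isDivisionPetit [Module F V] [IsScalarTower F K V] [FiniteDimensional F K]
    [FiniteDimensional K V] (hm : 2 ≤ m) : δ.diffPolyRing.IsDivisionPetit A.f m := by
  have hFV : FiniteDimensional F V := Module.Finite.trans K V
  refine ⟨⟨1, one_mem hm, ?_⟩, fun a ha ha0 => ⟨?_, ?_⟩⟩
  · intro h
    refine A.v₀_ne ?_
    rw [← S.Φ_one A.v₀, h]
    simpa using S.Φ_i 0 A.v₀
  · have hinj : Function.Injective (S.Φ a) := by
      rw [injective_iff_map_eq_zero]
      intro w hw
      by_contra hne
      exact A.Φ_ne_zero hne ha ha0 hw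
    let L : V →ₗ[F] V :=
      { toFun := S.Φ a
        map_add' := _root_.map_add _
        map_smul' := fun c v => by
          rw [RingHom.id_apply, ← algebraMap_smul K c v, ← algebraMap_smul K c (S.Φ a v),
            ← S.r_algebraMap, S.Φ_r, S.r_algebraMap] }
    have hsurj : Function.Surjective (S.Φ a) :=
      (LinearMap.injective_iff_surjective (f := L)).1 hinj
    refine ⟨fun x _ => A.pmul_mem a x, fun x hx y hy hxy => ?_, fun z hz => ?_⟩
    · have h := congrArg (fun u => S.Φ u A.v₀) hxy
      simp only [A.Φ_pmul] at h
      exact A.eq_of_Φ_eq A.v₀_ne hx hy (hinj h)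
    · obtain ⟨v, hv⟩ := hsurj (S.Φ z A.v₀)
      obtain ⟨x, hx, hxv⟩ := A.exists_Φ_eq A.v₀_ne v
      exact ⟨x, hx, A.eq_of_Φ_eq A.v₀_ne (A.pmul_mem _ _) hz (by rw [A.Φ_pmul, hxv, hv])⟩
  · have hw := A.Φ_ne_zero A.v₀_ne ha ha0
    refine ⟨fun x _ => A.pmul_mem x a, fun x hx y hy hxy => ?_, fun z hz => ?_⟩
    · have h := congrArg (fun u => S.Φ u A.v₀) hxy
      simp only [A.Φ_pmul] at h
      exact A.eq_of_Φ_eq hw hx hy h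
    · obtain ⟨x, hx, hxv⟩ := A.exists_Φ_eq hw (S.Φ z A.v₀)
      exact ⟨x, hx, A.eq_of_Φ_eq A.v₀_ne (A.pmul_mem _ _) hz (by rw [A.Φ_pmul, hxv])⟩

include A in
theorem finrank_Rlt [Module F V] [IsScalarTower F K V] [FiniteDimensional K V] :
    Module.finrank F (δ.diffPolyRing.Rlt m) = m * Module.finrank F K := by
  let L : δ.diffPolyRing.Rlt m →ₗ[F] V :=
    { toFun := fun x => S.Φ x A.v₀
      map_add' := fun x y => S.Φ_add x y A.v₀
      map_smul' := fun c x => by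
        rw [DiffPolyRing.smul_coe, S.Φ_mul, S.Φ_i, algebraMap_smul]; rfl }
  have hL : Function.Bijective L := by
    refine ⟨fun x y h => Subtype.ext (A.eq_of_Φ_eq A.v₀_ne x.2 y.2 h), fun v => ?_⟩
    obtain ⟨x, hx, hxv⟩ := A.exists_Φ_eq A.v₀_ne v
    exact ⟨⟨x, hx⟩, hxv⟩
  rw [(LinearEquiv.ofBijective L hL).finrank_eq, ← Module.finrank_mul_finrank F K V,
    A.finrank_eq, mul_comm]

theorem mem_nucr_iff {x : δ.polyRing} (hx : x ∈ δ.diffPolyRing.SfSet m) :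
    x ∈ δ.diffPolyRing.nucr A.f m ↔ ∀ y ∈ δ.diffPolyRing.SfSet m, ∀ z ∈ δ.diffPolyRing.SfSet m,
      S.Φ (δ.diffPolyRing.pmul A.f y z) (S.Φ x A.v₀) = S.Φ y (S.Φ z (S.Φ x A.v₀)) := by
  refine (and_iff_right hx).trans (forall₄_congr fun y _ z _ => ?_)
  rw [← A.Φ_pmul, ← A.Φ_pmul z, ← A.Φ_pmul y]
  exact ⟨fun h => by rw [h], A.eq_of_Φ_eq A.v₀_ne (A.pmul_mem _ _) (A.pmul_mem _ _)⟩

theorem mem_nucr_of_eq_r {x : δ.polyRing} (hx : x ∈ δ.diffPolyRing.SfSet m) {d : E}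
    (h : S.Φ x A.v₀ = S.r d A.v₀) : x ∈ δ.diffPolyRing.nucr A.f m := by
  rw [A.mem_nucr_iff hx]
  intro y _ z _
  rw [h, S.Φ_r, S.Φ_r, S.Φ_r, A.Φ_pmul]

theorem exists_eq_r [FiniteDimensional K V] (hm : 2 ≤ m) {x : δ.polyRing}
    (hx : x ∈ δ.diffPolyRing.nucr A.f m) : ∃ d, S.Φ x A.v₀ = S.r d A.v₀ := by
  have h := (A.mem_nucr_iff hx.1).1 hx
  choose y hy hyv using fun v => A.exists_Φ_eq A.v₀_ne v
  have huniq (v) (z) (hz : z ∈ δ.diffPolyRing.SfSet m) (hzv : S.Φ z A.v₀ = v) : y v = z :=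
    A.eq_of_Φ_eq A.v₀_ne (hy v) hz (by rw [hyv, hzv])
  let L : V →ₗ[K] V :=
    { toFun := fun v => S.Φ (y v) (S.Φ x A.v₀)
      map_add' := fun v w => by
        rw [huniq (v + w) (y v + y w) (δ.diffPolyRing.deg_add_lt (hy v) (hy w))
          (by rw [S.Φ_add, hyv, hyv]), S.Φ_add]
      map_smul' := fun a v => by
        rw [huniq (a • v) (δ.diffPolyRing.i a * y v) (i_mul_mem (hy v) a)
          (by rw [S.Φ_mul, S.Φ_i, hyv]), S.Φ_mul, S.Φ_i, RingHom.id_apply] }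
  have ht : δ.diffPolyRing.t ∈ δ.diffPolyRing.SfSet m := by
    simpa using t_pow_mem (δ := δ) (show 1 < m by omega)
  obtain ⟨d, hd⟩ := S.exists_r L fun v => by
    change S.T (S.Φ (y v) _) = S.Φ (y (S.T v)) _
    rw [huniq (S.T v) _ (A.pmul_mem δ.diffPolyRing.t (y v)) (by rw [A.Φ_pmul, hyv, S.Φ_t]),
      h _ ht _ (hy v), S.Φ_t]
  refine ⟨d, ?_⟩
  rw [← hd]
  change _ = S.Φ (y A.v₀) _
  rw [huniq A.v₀ 1 (one_mem hm) (S.Φ_one _), S.Φ_one]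

theorem rightNucPresents [FiniteDimensional K V] (hm : 2 ≤ m) :
    δ.diffPolyRing.RightNucPresents F A.f m E := by
  choose y hy hyd using fun d : E => A.exists_Φ_eq A.v₀_ne (S.r d A.v₀)
  let φ (d : E) : δ.diffPolyRing.nucr A.f m := ⟨y d, A.mem_nucr_of_eq_r (hy d) (hyd d)⟩
  have hφ : Function.Bijective φ := by
    refine ⟨fun d d' h => S.r_injective A.v₀_ne ?_, fun x => ?_⟩
    · have h : y d = y d' := congrArg Subtype.val h
      change S.r d A.v₀ = S.r d' A.v₀
      rw [← hyd, ← hyd, h]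
    · obtain ⟨d, hd⟩ := A.exists_eq_r hm x.2
      exact ⟨d, Subtype.ext (A.eq_of_Φ_eq A.v₀_ne (hy d) x.2.1 (by rw [hyd, hd]))⟩
  refine ⟨Equiv.ofBijective φ hφ, fun c d => ?_, fun c d => ?_, fun c => ?_⟩
  · refine A.eq_of_Φ_eq A.v₀_ne (hy _) (δ.diffPolyRing.deg_add_lt (hy _) (hy _)) ?_
    change S.Φ (y (c + d)) _ = S.Φ (y c + y d) _
    rw [S.Φ_add, hyd, hyd, hyd, S.r_add]
  · refine A.eq_of_Φ_eq A.v₀_ne (hy _) (A.pmul_mem _ _) ?_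
    change S.Φ (y (c * d)) _ = S.Φ (δ.diffPolyRing.pmul A.f (y c) (y d)) _
    rw [hyd, A.Φ_pmul, hyd d, S.Φ_r, hyd c, S.r_mul]
  · refine A.eq_of_Φ_eq A.v₀_ne (hy _) (i_mem hm _) ?_
    change S.Φ (y (algebraMap F E c)) _ = _
    rw [hyd, S.Φ_i, S.r_algebraMap]

theorem deg_eq_of_mem {x : δ.polyRing} (hx : x ∈ δ.diffPolyRing.SfSet m)
    (hx' : x ∉ Set.range δ.diffPolyRing.i) :
    ∃ n < m, δ.diffPolyRing.deg x + (n : ℕ) = m := by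
  have h0 : ¬ δ.diffPolyRing.deg x ≤ 0 := fun h => hx' (eq_i_of_deg_le h)
  cases hd : δ.diffPolyRing.deg x with
  | bot => simp [hd] at h0
  | coe k =>
    replace hd : δ.diffPolyRing.deg x = (k : ℕ) := hd
    have hk : k < m := by
      have : δ.diffPolyRing.deg x < m := hx
      rw [hd] at this
      exact_mod_cast this
    have hk0 : ¬ k ≤ 0 := by
      rw [hd] at h0
      exact_mod_cast h0
    exact ⟨m - k, by omega, congrArg (Nat.cast : ℕ → WithBot ℕ) (Nat.add_sub_cancel' hk.le)⟩

/-- The intermediate field `E ∩ K` of elements acting on `v₀` in the same way as an element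
of `E`. -/
def interField : IntermediateField F K where
  carrier := {a | ∃ d, S.r d A.v₀ = a • A.v₀}
  mul_mem' := by
    rintro a b ⟨d, hd⟩ ⟨d', hd'⟩
    exact ⟨d * d', by rw [S.r_mul, hd, map_smul, hd', mul_smul]⟩
  add_mem' := by
    rintro a b ⟨d, hd⟩ ⟨d', hd'⟩
    exact ⟨d + d', by rw [S.r_add, hd, hd', add_smul]⟩
  algebraMap_mem' c := ⟨algebraMap F E c, S.r_algebraMap c _⟩
  inv_mem' := by
    rintro a ⟨d, hd⟩
    rcases eq_or_ne a 0 with rfl | ha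
    · exact ⟨0, by simp [S.r_zero]⟩
    have hd0 : d ≠ 0 := by
      rintro rfl
      rw [S.r_zero] at hd
      exact smul_ne_zero ha A.v₀_ne hd.symm
    refine ⟨d⁻¹, ?_⟩
    have h := S.r_inv_r hd0 A.v₀
    rw [hd, map_smul] at h
    rw [← h, smul_smul, inv_mul_cancel₀ ha, one_smul, h]

section Nuclei

variable [FiniteDimensional F K]

include A in
theorem exists_Φ_smul_ne (hδ : δ.HasConstants F) (hm : 2 ≤ m) (hlt : m < Module.finrank F K)
    {w : V} (hw : w ≠ 0) {x z : δ.polyRing} (hx : δ.diffPolyRing.deg x = m)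
    (hz : z ∈ δ.diffPolyRing.SfSet m) : ∃ a : K, S.Φ x (a • w) ≠ S.Φ z (a • w) := by
  have hV := A.finrank_eq
  obtain ⟨a, ha⟩ := S.exists_act_smul_ne_zero hδ (by omega) (by omega) hw
    (P := δ.toPoly (x - z)) (by
      rw [_root_.map_sub, hV, degree_sub_eq_left_of_degree_lt]
      · exact hx
      · exact hz.trans_eq hx.symm)
  refine ⟨a, fun h => ha ?_⟩
  change S.Φ (x - z) _ = 0
  rw [S.Φ_sub, h, sub_self]

theorem nucl_eq (hδ : δ.HasConstants F) (hm : 2 ≤ m) (hlt : m < Module.finrank F K) :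
    δ.diffPolyRing.nucl A.f m = Set.range δ.diffPolyRing.i := by
  refine Set.Subset.antisymm (fun x hx => ?_) ?_
  · by_contra hx'
    obtain ⟨n, hn, hdeg⟩ := deg_eq_of_mem hx.1 hx'
    obtain ⟨a, ha⟩ := A.exists_Φ_smul_ne hδ hm hlt A.v₀_ne
      (x := x * δ.diffPolyRing.t ^ n) (by rwa [deg_mul, deg_t_pow])
      (A.pmul_mem x (δ.diffPolyRing.t ^ n))
    have h := congrArg (fun u => S.Φ u A.v₀)
      (hx.2 _ (t_pow_mem hn) _ (i_mem hm a))
    simp only [A.Φ_pmul, S.Φ_i] at h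
    exact ha (by rw [h, S.Φ_mul])
  · rintro _ ⟨a, rfl⟩
    refine ⟨i_mem hm a, fun y hy z hz => ?_⟩
    rw [A.pmul_eq (i_mul_mem hy a)]
    refine A.eq_of_Φ_eq A.v₀_ne (A.pmul_mem _ _) (A.pmul_mem _ _) ?_
    simp only [A.Φ_pmul, S.Φ_mul]

theorem nucm_eq (hδ : δ.HasConstants F) (hm : 2 ≤ m) (hlt : m < Module.finrank F K) :
    δ.diffPolyRing.nucm A.f m = Set.range δ.diffPolyRing.i := by
  refine Set.Subset.antisymm (fun x hx => ?_) ?_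
  · by_contra hx'
    obtain ⟨n, hn, hdeg⟩ := deg_eq_of_mem hx.1 hx'
    obtain ⟨a, ha⟩ := A.exists_Φ_smul_ne hδ hm hlt A.v₀_ne
      (x := δ.diffPolyRing.t ^ n * x) (by rwa [deg_mul, deg_t_pow, add_comm])
      (A.pmul_mem (δ.diffPolyRing.t ^ n) x)
    have h := congrArg (fun u => S.Φ u A.v₀)
      (hx.2 _ (t_pow_mem hn) _ (i_mem hm a))
    simp only [A.Φ_pmul, S.Φ_i] at h
    exact ha (by rw [h, S.Φ_mul])
  · rintro _ ⟨a, rfl⟩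
    refine ⟨i_mem hm a, fun y hy z hz => ?_⟩
    rw [A.pmul_eq (mul_i_mem hy a)]
    refine A.eq_of_Φ_eq A.v₀_ne (A.pmul_mem _ _) (A.pmul_mem _ _) ?_
    simp only [A.Φ_pmul, S.Φ_mul]

theorem nuc_eq (hδ : δ.HasConstants F) (hm : 2 ≤ m) (hlt : m < Module.finrank F K) :
    δ.diffPolyRing.nuc A.f m = δ.diffPolyRing.nucr A.f m ∩ Set.range δ.diffPolyRing.i := by
  rw [DiffPolyRing.nuc, A.nucl_eq hδ hm hlt, A.nucm_eq hδ hm hlt, Set.inter_self, Set.inter_comm]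

theorem exists_intermediateField [FiniteDimensional K V] (hδ : δ.HasConstants F) (hm : 2 ≤ m)
    (hlt : m < Module.finrank F K) : ∃ L : IntermediateField F K,
      δ.diffPolyRing.nuc A.f m = δ.diffPolyRing.i '' (L : Set K) ∧ L ≠ ⊤ := by
  refine ⟨A.interField, ?_, fun htop => ?_⟩
  · rw [A.nuc_eq hδ hm hlt]
    ext x
    constructor
    · rintro ⟨hx, a, rfl⟩
      obtain ⟨d, hd⟩ := A.exists_eq_r hm hx
      exact ⟨a, ⟨d, by rw [← hd, S.Φ_i]⟩, rfl⟩
    · rintro ⟨a, ⟨d, hd⟩, rfl⟩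
      exact ⟨A.mem_nucr_of_eq_r (i_mem hm a) (d := d) (by rw [hd, S.Φ_i]), a, rfl⟩
  · obtain ⟨a, ha⟩ := A.exists_Φ_smul_ne hδ hm hlt A.v₀_ne A.deg_f (z := 0)
      (δ.diffPolyRing.res m).zero_mem
    have hmem : a ∈ A.interField := htop ▸ IntermediateField.mem_top
    obtain ⟨d, hd⟩ := hmem
    refine ha ?_
    rw [← hd, S.Φ_r, A.Φ_f, S.Φ_r, ← _root_.map_zero δ.diffPolyRing.i, S.Φ_i, zero_smul]

end Nuclei

end Annihilator

end SimpleAction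

end Der

/-- Let `Dv` be a division `p`-algebra of degree `m` over `F` split by a
purely inseparable extension `K/F` of exponent one with `m < [K:F] = p^e`.  Then there are a
derivation `δ` on `K` with constants `F` and an irreducible `f ∈ K[t;δ]` of degree `m` such
that `S_f` is a division algebra over `F` of dimension `m·p^e` with right nucleus
isomorphic to `Dv`, left and middle nuclei equal to `K`, and nucleus `Dv ∩ K` an
intermediate field of `K/F` properly contained in `K`. -/
theorem statement_10 (p : ℕ) [Fact p.Prime] (F K Dv : Type) [Field F] [CharP F p]
    [Field K] [Algebra F K] [DivisionRing Dv] [Algebra F Dv] (e m : ℕ) (hm : 2 ≤ m)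
    (hmlt : m < p ^ e)
    (hpureinsep : ∀ z : K, z ^ p ∈ (algebraMap F K).range)
    (hdim : Module.finrank F K = p ^ e)
    (hcentral : Algebra.IsCentral F Dv) (hdegD : Module.finrank F Dv = m ^ 2)
    (hppow : ∃ n : ℕ, m = p ^ n)
    (hsplit : Nonempty ((K ⊗[F] Dv) ≃ₐ[K] Matrix (Fin m) (Fin m) K)) :
    ∃ δ : Der K, δ.HasConstants F ∧
      ∃ (R : Type) (_ : Ring R) (D : DiffPolyRing K δ R) (f : R),
        D.deg f = (m : WithBot ℕ) ∧
        D.Irred f ∧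
        D.PetitUnital f m ∧
        D.IsDivisionPetit f m ∧
        Module.finrank F (D.Rlt m) = m * p ^ e ∧
        D.RightNucPresents F f m Dv ∧
        D.nucl f m = Set.range D.i ∧
        D.nucm f m = Set.range D.i ∧
        D.nuc f m = D.nucr f m ∩ Set.range D.i ∧
        ∃ E : IntermediateField F K, D.nuc f m = D.i '' (E : Set K) ∧ E ≠ ⊤ := by
  have : CharP K p := charP_of_injective_algebraMap (algebraMap F K).injective p
  have : FiniteDimensional F K := Module.finite_of_finrank_pos (by omega)
  have : FiniteDimensional F Dv := Module.finite_of_finrank_pos (by rw [hdegD]; positivity)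
  have : Nonempty (Fin m) := ⟨⟨0, by omega⟩⟩
  have hlt : m < Module.finrank F K := by rwa [hdim]
  obtain ⟨d, hd⟩ := exists_derivation_constants p F K hpureinsep
  let δ : Der K :=
    { toFun := d
      map_add' := map_add d
      leibniz' := fun a b => by rw [d.leibniz, smul_eq_mul, smul_eq_mul, mul_comm b] }
  have hδ : δ.HasConstants F := hd
  obtain ⟨Ψ⟩ := hsplit
  obtain ⟨S⟩ := δ.nonempty_simpleAction hδ Ψ
  obtain ⟨A⟩ := Der.SimpleAction.nonempty_annihilator (S := S) (Module.finrank_fin_fun K) hm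
  exact ⟨δ, hδ, δ.polyRing, inferInstance, δ.diffPolyRing, A.f, A.deg_f, A.irred hm,
    A.petitUnital hm, A.isDivisionPetit hm, by rw [A.finrank_Rlt, hdim], A.rightNucPresents hm,
    A.nucl_eq hδ hm hlt, A.nucm_eq hδ hm hlt, A.nuc_eq hδ hm hlt,
    A.exists_intermediateField hδ hm hlt⟩
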